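/- Let H be a virtually-full, virtually-coabelian subgroup of corank r of a direct product D = Γ_1 × … × Γ_n, where each Γ_i is finitely presented and n ≥ max{3, 2r}. Let β_1 and β_2 be the Dehn functions of some finite presentations of Γ_1 × … × Γ_{n-r} and of Γ_{n-r+1} × … × Γ_n respectively. Then the function β defined by β(l) = l·β_1(l²) + β_2(l) is an isoperimetric function for H. -/

import Mathlib

open Subgroup

/-- Reduced word length in a free group. -/
noncomputable def fgNorm {X : Type*} (w : FreeGroup X) : ℕ :=
  @FreeGroup.norm X (Classical.decEq X) w

/-- `w` is a product of exactly `N` conjugates of elements of `R ∪ R⁻¹`. -/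
def ExprOf {X : Type*} (R : Set (FreeGroup X)) (w : FreeGroup X) (N : ℕ) : Prop :=
  ∃ l : List (FreeGroup X × FreeGroup X),
    l.length = N ∧ (∀ p ∈ l, p.2 ∈ R ∨ p.2⁻¹ ∈ R) ∧
    (l.map fun p => p.1 * p.2 * p.1⁻¹).prod = w

/-- The area of a null-homotopic word: the least number of conjugates of relators needed. -/
noncomputable def area {X : Type*} (R : Set (FreeGroup X)) (w : FreeGroup X) : ℕ :=
  sInf {N | ExprOf R w N}

/-- The Dehn function of the presentation with relator set `R`. -/
noncomputable def dehn {X : Type*} (R : Set (FreeGroup X)) (l : ℕ) : ℕ :=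
  sSup {A | ∃ w ∈ Subgroup.normalClosure R, fgNorm w ≤ l ∧ A = area R w}

/-- `f ⪯ g`. -/
def Preceq (f g : ℕ → ℕ) : Prop := ∃ C : ℕ, ∀ l, f l ≤ C * g (C * l + C) + C * l + C

/-- `f ≃ g`. -/
def FEquiv (f g : ℕ → ℕ) : Prop := Preceq f g ∧ Preceq g f

/-- `φ` realizes `⟨X | R⟩` as a presentation of `G`. -/
def Presents {X : Type*} {G : Type*} [Group G] (R : Set (FreeGroup X))
    (φ : FreeGroup X →* G) : Prop :=
  Function.Surjective φ ∧ φ.ker = Subgroup.normalClosure R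

def FinitelyPresentedGroup (G : Type*) [Group G] : Prop :=
  ∃ (X : Type) (_ : Finite X) (R : Set (FreeGroup X)) (φ : FreeGroup X →* G),
    R.Finite ∧ Presents R φ

/-- `f` is an isoperimetric function for `G` : the Dehn function of every finite
presentation of `G` is `⪯ f`. -/
def IsIsopFunction (G : Type*) [Group G] (f : ℕ → ℕ) : Prop :=
  ∀ (X : Type) (R : Set (FreeGroup X)) (φ : FreeGroup X →* G),
    Finite X → R.Finite → Presents R φ → Preceq (dehn R) f

/-- `(α, ρ)` is an area-radius pair for the presentation with relator set `R`. -/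
def IsAreaRadiusPair {X : Type*} (R : Set (FreeGroup X)) (α ρ : ℕ → ℕ) : Prop :=
  ∀ w ∈ Subgroup.normalClosure R, ∀ l : ℕ, fgNorm w ≤ l →
    ∃ L : List (FreeGroup X × FreeGroup X), L.length ≤ α l ∧
      (∀ p ∈ L, (p.2 ∈ R ∨ p.2⁻¹ ∈ R) ∧ fgNorm p.1 ≤ ρ l) ∧
      (L.map fun p => p.1 * p.2 * p.1⁻¹).prod = w

/-- `g` is a product of at most `k` elements of `S ∪ S⁻¹`. -/
def WordLe {G : Type*} [Group G] (S : Set G) (g : G) (k : ℕ) : Prop :=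
  ∃ l : List G, l.length ≤ k ∧ (∀ x ∈ l, x ∈ S ∨ x⁻¹ ∈ S) ∧ l.prod = g

/-- Word length of `g` with respect to the generating set `S`. -/
noncomputable def wordLength {G : Type*} [Group G] (S : Set G) (g : G) : ℕ :=
  sInf {k | WordLe S g k}

open scoped TensorProduct

/-! ### Area calculus in free groups -/

namespace FreeGroup

variable {X Y : Type*}

lemma fgNorm_mk_le (L : List (X × Bool)) : fgNorm (mk L) ≤ L.length := by
  classical
  exact norm_mk_le

lemma exists_mk_eq_of_fgNorm (w : FreeGroup X) :
    ∃ L : List (X × Bool), mk L = w ∧ L.length = fgNorm w := by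
  classical
  exact ⟨w.toWord, mk_toWord, by unfold fgNorm norm; congr⟩

lemma fgNorm_one : fgNorm (1 : FreeGroup X) = 0 := by
  classical
  exact norm_one

lemma fgNorm_of (x : X) : fgNorm (of x) = 1 := by
  classical
  exact norm_of x

lemma fgNorm_inv (w : FreeGroup X) : fgNorm w⁻¹ = fgNorm w := by
  classical
  exact norm_inv_eq

lemma fgNorm_mul_le (u v : FreeGroup X) : fgNorm (u * v) ≤ fgNorm u + fgNorm v := by
  classical
  exact norm_mul_le u v

lemma fgNorm_pow_le (u : FreeGroup X) (n : ℕ) : fgNorm (u ^ n) ≤ n * fgNorm u := by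
  induction n with
  | zero => simp [fgNorm_one]
  | succ n ih =>
    rw [pow_succ]
    refine (fgNorm_mul_le _ _).trans ?_
    rw [add_mul]
    omega

lemma mk_cons (a : X × Bool) (L : List (X × Bool)) :
    mk (a :: L) = (if a.2 then of a.1 else (of a.1)⁻¹) * mk L := by
  rcases a with ⟨x, b⟩
  cases b <;> rfl

/-- Induction on free group elements together with a bound on their length. -/
lemma induction_fgNorm {P : FreeGroup X → ℕ → Prop} (one : P 1 0)
    (of_mul : ∀ x w n, fgNorm w ≤ n → P w n → P (of x * w) (n + 1))
    (inv_of_mul : ∀ x w n, fgNorm w ≤ n → P w n → P ((of x)⁻¹ * w) (n + 1))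
    (w : FreeGroup X) : P w (fgNorm w) := by
  obtain ⟨L, rfl, hL⟩ := exists_mk_eq_of_fgNorm w
  rw [← hL]
  clear hL
  induction L with
  | nil => exact one
  | cons a L ih =>
    rw [mk_cons, List.length_cons]
    rcases a with ⟨x, b⟩
    cases b
    · exact inv_of_mul x _ _ (fgNorm_mk_le L) ih
    · exact of_mul x _ _ (fgNorm_mk_le L) ih

lemma fgNorm_map_le [Finite X] (f : FreeGroup X →* FreeGroup Y) :
    ∃ C, ∀ w, fgNorm (f w) ≤ C * fgNorm w := by
  obtain ⟨C, hC⟩ := (Set.finite_range fun x => fgNorm (f (of x))).bddAbove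
  refine ⟨C, fun w => ?_⟩
  have h : ∀ x, fgNorm (f (of x)) ≤ C := fun x => hC ⟨x, rfl⟩
  refine induction_fgNorm (P := fun w n => fgNorm (f w) ≤ C * n) ?_ ?_ ?_ w
  · simp [fgNorm_one]
  · intro x w n _ ih
    rw [_root_.map_mul, mul_add, mul_one]
    have := fgNorm_mul_le (f (of x)) (f w)
    have := h x
    omega
  · intro x w n _ ih
    rw [_root_.map_mul, _root_.map_inv, mul_add, mul_one]
    have := fgNorm_mul_le (f (of x))⁻¹ (f w)
    rw [fgNorm_inv] at this
    have := h x
    omega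

lemma finite_fgNorm_le [Finite X] (l : ℕ) : {w : FreeGroup X | fgNorm w ≤ l}.Finite := by
  refine ((List.finite_length_le (X × Bool) l).image mk).subset ?_
  intro w hw
  obtain ⟨L, rfl, hL⟩ := exists_mk_eq_of_fgNorm w
  exact ⟨L, by simpa [hL] using hw, rfl⟩

end FreeGroup

/-- `w` is a product of at most `N` conjugates of elements of `R ∪ R⁻¹`. -/
def AreaLE {X : Type*} (R : Set (FreeGroup X)) (w : FreeGroup X) (N : ℕ) : Prop :=
  ∃ k ≤ N, ExprOf R w k

namespace AreaLE

variable {X Y : Type*} {R : Set (FreeGroup X)} {u v w : FreeGroup X} {M N : ℕ}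

lemma one (R : Set (FreeGroup X)) (N : ℕ) : AreaLE R 1 N := ⟨0, N.zero_le, [], by simp⟩

lemma mono (h : AreaLE R w M) (hMN : M ≤ N) : AreaLE R w N := by
  obtain ⟨k, hk, h⟩ := h
  exact ⟨k, hk.trans hMN, h⟩

lemma of_mem (h : w ∈ R) : AreaLE R w 1 := ⟨1, le_rfl, [(1, w)], by simp [h]⟩

lemma mul (hu : AreaLE R u M) (hv : AreaLE R v N) : AreaLE R (u * v) (M + N) := by
  obtain ⟨k, hk, l, rfl, hl, rfl⟩ := hu
  obtain ⟨k', hk', l', rfl, hl', rfl⟩ := hv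
  refine ⟨_, add_le_add hk hk', l ++ l', by simp, ?_, by simp⟩
  intro p hp
  rcases List.mem_append.1 hp with h | h
  exacts [hl p h, hl' p h]

lemma induction {P : FreeGroup X → ℕ → Prop} (one : P 1 0)
    (conj_mul : ∀ g r w n, r ∈ R → P w n → P (g * r * g⁻¹ * w) (n + 1))
    (conj_inv_mul : ∀ g r w n, r ∈ R → P w n → P (g * r⁻¹ * g⁻¹ * w) (n + 1))
    (mono : ∀ w m n, m ≤ n → P w m → P w n) (h : AreaLE R w N) : P w N := by
  obtain ⟨k, hk, l, rfl, hl, rfl⟩ := h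
  refine mono _ _ _ hk ?_
  clear hk
  induction l with
  | nil => exact one
  | cons p l ih =>
    have ih := ih fun q hq => hl q (List.mem_cons_of_mem _ hq)
    simp only [List.map_cons, List.prod_cons, List.length_cons]
    rcases hl p List.mem_cons_self with h | h
    · exact conj_mul _ _ _ _ h ih
    · have := conj_inv_mul p.1 _ _ _ h ih
      rwa [inv_inv] at this

lemma of_mem_inv (h : w ∈ R) : AreaLE R w⁻¹ 1 := ⟨1, le_rfl, [(1, w⁻¹)], by simp [h]⟩

lemma conj (g : FreeGroup X) (h : AreaLE R w N) : AreaLE R (g * w * g⁻¹) N := by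
  obtain ⟨k, hk, l, rfl, hl, rfl⟩ := h
  refine ⟨_, hk, l.map fun p => (g * p.1, p.2), by simp, ?_, ?_⟩
  · intro p hp
    obtain ⟨q, hq, rfl⟩ := List.mem_map.1 hp
    exact hl q hq
  · clear hl hk
    induction l with
    | nil => simp
    | cons p l ih =>
      simp only [List.map_cons, List.prod_cons] at ih ⊢
      rw [ih]
      group

lemma inv (h : AreaLE R w N) : AreaLE R w⁻¹ N := by
  refine AreaLE.induction (P := fun w n => AreaLE R w⁻¹ n) ?_ ?_ ?_ ?_ h
  · simpa using one R 0
  · intro g r w n hr ih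
    simpa [mul_assoc] using ih.mul ((of_mem_inv hr).conj g)
  · intro g r w n hr ih
    simpa [mul_assoc] using ih.mul ((of_mem hr).conj g)
  · intro w m n hmn h
    exact h.mono hmn

lemma map (f : FreeGroup X →* FreeGroup Y) {S : Set (FreeGroup Y)} {K : ℕ}
    (hf : ∀ r ∈ R, AreaLE S (f r) K) (h : AreaLE R w N) : AreaLE S (f w) (K * N) := by
  refine AreaLE.induction (P := fun w n => AreaLE S (f w) (K * n)) ?_ ?_ ?_ ?_ h
  · simpa using one S 0
  · intro g r w n hr ih
    simpa [mul_add, add_comm] using ((hf r hr).conj (f g)).mul ih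
  · intro g r w n hr ih
    simpa [mul_add, add_comm] using ((hf r hr).inv.conj (f g)).mul ih
  · intro w m n hmn h
    exact h.mono (Nat.mul_le_mul_left _ hmn)

lemma map_eq_one {G : Type*} [Group G] (f : FreeGroup X →* G) (hf : ∀ r ∈ R, f r = 1)
    (h : AreaLE R w N) : f w = 1 := by
  refine AreaLE.induction (P := fun w _ => f w = 1) (map_one f) ?_ ?_ ?_ h
  · intro g r w n hr ih
    simp [ih, hf r hr]
  · intro g r w n hr ih
    simp [ih, hf r hr]
  · exact fun w m n _ h => h

lemma of_mem_normalClosure (h : w ∈ Subgroup.normalClosure R) : ∃ N, AreaLE R w N := by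
  let S : Subgroup (FreeGroup X) :=
    { carrier := {w | ∃ N, AreaLE R w N}
      one_mem' := ⟨0, one R 0⟩
      mul_mem' := fun ⟨M, hM⟩ ⟨N, hN⟩ => ⟨_, hM.mul hN⟩
      inv_mem' := fun ⟨M, hM⟩ => ⟨_, hM.inv⟩ }
  have : S.Normal := ⟨fun w ⟨N, hN⟩ g => ⟨N, hN.conj g⟩⟩
  exact Subgroup.normalClosure_le_normal (N := S) (fun x hx => ⟨1, of_mem hx⟩) h

lemma area_le (h : AreaLE R w N) : area R w ≤ N := by
  obtain ⟨k, hk, h⟩ := h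
  exact (Nat.sInf_le h).trans hk

lemma of_area (h : w ∈ Subgroup.normalClosure R) : AreaLE R w (area R w) := by
  obtain ⟨N, k, -, hk⟩ := of_mem_normalClosure h
  exact ⟨_, le_rfl, Nat.sInf_mem (s := {N | ExprOf R w N}) ⟨k, hk⟩⟩

end AreaLE

lemma finite_dehn_set {X : Type*} [Finite X] (R : Set (FreeGroup X)) (l : ℕ) :
    {A | ∃ w ∈ Subgroup.normalClosure R, fgNorm w ≤ l ∧ A = area R w}.Finite := by
  refine ((FreeGroup.finite_fgNorm_le l).image (area R)).subset ?_
  rintro A ⟨w, -, hw, rfl⟩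
  exact ⟨w, hw, rfl⟩

lemma area_le_dehn {X : Type*} [Finite X] {R : Set (FreeGroup X)} {w : FreeGroup X} {l : ℕ}
    (hw : w ∈ Subgroup.normalClosure R) (hl : fgNorm w ≤ l) : area R w ≤ dehn R l :=
  le_csSup (finite_dehn_set R l).bddAbove ⟨w, hw, hl, rfl⟩

lemma dehn_le {X : Type*} {R : Set (FreeGroup X)} {l N : ℕ}
    (h : ∀ w ∈ Subgroup.normalClosure R, fgNorm w ≤ l → AreaLE R w N) : dehn R l ≤ N := by
  refine csSup_le ⟨_, 1, one_mem _, ?_, rfl⟩ ?_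
  · rw [FreeGroup.fgNorm_one]
    exact l.zero_le
  · rintro A ⟨w, hw, hl, rfl⟩
    exact (h w hw hl).area_le

lemma dehn_mono {X : Type*} [Finite X] (R : Set (FreeGroup X)) : Monotone (dehn R) := by
  intro l m hlm
  exact dehn_le fun w hw hl =>
    (AreaLE.of_area hw).mono (area_le_dehn hw (hl.trans hlm))

/-- `u` and `v` differ by a product of at most `N` conjugates of relators. -/
def Near {X : Type*} (R : Set (FreeGroup X)) (N : ℕ) (u v : FreeGroup X) : Prop :=
  AreaLE R (u * v⁻¹) N

namespace Near

variable {X : Type*} {R : Set (FreeGroup X)} {u v w u' v' : FreeGroup X} {M N : ℕ}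

lemma refl (u : FreeGroup X) : Near R N u u := by
  simpa [Near] using AreaLE.one R N

lemma of_eq (h : u = v) : Near R N u v := h ▸ refl u

lemma mono (h : Near R M u v) (hMN : M ≤ N) : Near R N u v := AreaLE.mono h hMN

lemma symm (h : Near R N u v) : Near R N v u := by
  simpa [Near] using AreaLE.inv h

lemma trans (h : Near R M u v) (h' : Near R N v w) : Near R (M + N) u w := by
  simpa [Near] using AreaLE.mul h h'

lemma mul (h : Near R M u v) (h' : Near R N u' v') : Near R (M + N) (u * u') (v * v') := by
  simpa [Near, mul_assoc, add_comm] using (AreaLE.conj u h').mul h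

lemma mul_left (g : FreeGroup X) (h : Near R N u v) : Near R N (g * u) (g * v) := by
  simpa using (refl (N := 0) g).mul h

lemma mul_right (g : FreeGroup X) (h : Near R N u v) : Near R N (u * g) (v * g) := by
  simpa using h.mul (refl (N := 0) g)

lemma conj (g : FreeGroup X) (h : Near R N u v) : Near R N (g * u * g⁻¹) (g * v * g⁻¹) :=
  (h.mul_left g).mul_right g⁻¹

lemma inv (h : Near R N u v) : Near R N u⁻¹ v⁻¹ := by
  have := ((h.mul_left u⁻¹).mul_right v⁻¹).symm
  simpa using this

lemma conj_congr (h : Near R M u v) (h' : Near R N w w') :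
    Near R (2 * M + N) (u * w * u⁻¹) (v * w' * v⁻¹) :=
  ((h.mul h').mul h.inv).mono (by omega)

lemma areaLE (h : Near R M u v) (hv : AreaLE R v N) : AreaLE R u (M + N) := by
  simpa using AreaLE.mul h hv

/-- Two homomorphisms that are near on the generators are near on all words. -/
lemma of_generators {Y : Type*} {f g : FreeGroup Y →* FreeGroup X} {K : ℕ}
    (h : ∀ y, Near R K (f (.of y)) (g (.of y))) (w : FreeGroup Y) :
    Near R (K * fgNorm w) (f w) (g w) := by
  refine FreeGroup.induction_fgNorm (P := fun w n => Near R (K * n) (f w) (g w)) ?_ ?_ ?_ w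
  · exact of_eq (by simp)
  · intro x w n _ ih
    rw [map_mul, map_mul]
    exact ((h x).mul ih).mono (by rw [mul_add]; omega)
  · intro x w n _ ih
    rw [map_mul, map_mul, map_inv, map_inv]
    exact ((h x).inv.mul ih).mono (by rw [mul_add]; omega)

end Near

/-- `u` and `v` commute up to a product of at most `N` conjugates of relators. -/
def NearCommute {X : Type*} (R : Set (FreeGroup X)) (N : ℕ) (u v : FreeGroup X) : Prop :=
  Near R N (u * v) (v * u)

namespace NearCommute

variable {X : Type*} {R : Set (FreeGroup X)} {u v w v' : FreeGroup X} {M N : ℕ}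

lemma mono (h : NearCommute R M u v) (hMN : M ≤ N) : NearCommute R N u v := Near.mono h hMN

lemma symm (h : NearCommute R N u v) : NearCommute R N v u := Near.symm h

lemma of_commute (h : Commute u v) : NearCommute R N u v := Near.of_eq h

lemma mul_right (h : NearCommute R M u v) (h' : NearCommute R N u w) :
    NearCommute R (M + N) u (v * w) := by
  have h₁ := Near.mul_right w h
  have h₂ := Near.mul_left v h'
  simp only [← mul_assoc] at h₁ h₂
  simpa only [NearCommute, ← mul_assoc] using h₁.trans h₂

lemma inv_right (h : NearCommute R N u v) : NearCommute R N u v⁻¹ := by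
  have := (Near.mul_right v⁻¹ (Near.mul_left v⁻¹ h)).symm
  simpa [NearCommute, mul_assoc] using this

lemma inv_left (h : NearCommute R N u v) : NearCommute R N u⁻¹ v := h.symm.inv_right.symm

lemma pow_right (h : NearCommute R N u v) (e : ℕ) : NearCommute R (N * e) u (v ^ e) := by
  induction e with
  | zero => exact of_commute (by simp)
  | succ e ih =>
    rw [pow_succ]
    exact (ih.mul_right h).mono (by rw [mul_add]; omega)

lemma zpow_right (h : NearCommute R N u v) (e : ℤ) :
    NearCommute R (N * e.natAbs) u (v ^ e) := by
  rcases Int.eq_nat_or_neg e with ⟨n, rfl | rfl⟩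
  · simpa using h.pow_right n
  · simpa using (h.pow_right n).inv_right

lemma conj_right (h : NearCommute R M u v) (h' : NearCommute R N u w) :
    NearCommute R (2 * M + N) u (v * w * v⁻¹) :=
  ((h.mul_right h').mul_right h.inv_right).mono (by omega)

lemma near_conj (h : NearCommute R N u v) : Near R N (u * v * u⁻¹) v := by
  simpa using Near.mul_right u⁻¹ h

lemma congr_right (h : NearCommute R N u v) (h' : Near R M v' v) :
    NearCommute R (N + 2 * M) u v' :=
  (((Near.mul_left u h').trans h).trans (Near.mul_right u h').symm).mono (by omega)

end NearCommute

/-! ### Commutation estimates -/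

section Commutation

variable {Y : Type*} {R : Set (FreeGroup Y)} {K : ℕ} {t c t' κ ζ x : FreeGroup Y}

lemma near_pow_conj (ht : Near R K t (c * t')) (hc : NearCommute R K t' c)
    (hκ : NearCommute R K t' κ) (e : ℕ) :
    Near R (K * (e * (e + 4))) (t ^ e * κ * (t ^ e)⁻¹) (c ^ e * κ * (c ^ e)⁻¹) := by
  induction e with
  | zero => exact Near.of_eq (by simp)
  | succ e ih =>
    have h₁ := ((hc.pow_right e).conj_right hκ).near_conj.conj c
    have h₂ := ht.conj_congr (Near.refl (R := R) (N := 0) (c ^ e * κ * (c ^ e)⁻¹))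
    have h₃ := ih.conj t
    have h₄ := (h₃.trans h₂).trans ((Near.of_eq (N := 0) (by group)).trans h₁)
    have e₁ : t ^ (e + 1) * κ * (t ^ (e + 1))⁻¹ = t * (t ^ e * κ * (t ^ e)⁻¹) * t⁻¹ := by
      rw [pow_succ']; group
    have e₂ : c ^ (e + 1) * κ * (c ^ (e + 1))⁻¹ = c * (c ^ e * κ * (c ^ e)⁻¹) * c⁻¹ := by
      rw [pow_succ']; group
    rw [e₁, e₂]
    exact h₄.mono (by ring_nf; omega)

lemma nearCommute_pow_conj_commutator (ht : Near R K t (c * t')) (hc : NearCommute R K t' c)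
    (hκ : NearCommute R K t' κ) (hζc : NearCommute R K ζ c) (hζκ : NearCommute R K ζ κ) (e : ℕ) :
    NearCommute R (K * (2 * e + 1) + 2 * (K * (e * (e + 4)))) ζ (t ^ e * κ * (t ^ e)⁻¹) :=
  (((hζc.pow_right e).conj_right hζκ).congr_right (near_pow_conj ht hc hκ e)).mono
    (by ring_nf; omega)

lemma nearCommute_pow_conj (ht : Near R K t (c * t')) (hc : NearCommute R K t' c)
    (hκ : NearCommute R K t' (t * x * t⁻¹ * x⁻¹)) (hζc : NearCommute R K ζ c)
    (hζκ : NearCommute R K ζ (t * x * t⁻¹ * x⁻¹)) (hζx : NearCommute R K ζ x) (e : ℕ) :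
    NearCommute R (K * (2 * (e + 1) ^ 3)) ζ (t ^ e * x * (t ^ e)⁻¹) := by
  induction e with
  | zero => exact (by simpa using hζx.mono (by omega))
  | succ e ih =>
    have h := (nearCommute_pow_conj_commutator ht hc hκ hζc hζκ e).mul_right ih
    have e₁ : t ^ (e + 1) * x * (t ^ (e + 1))⁻¹ =
        t ^ e * (t * x * t⁻¹ * x⁻¹) * (t ^ e)⁻¹ * (t ^ e * x * (t ^ e)⁻¹) := by
      rw [pow_succ]; group
    rw [e₁]
    refine h.mono ?_
    have : K * (2 * e + 1) + 2 * (K * (e * (e + 4))) + K * (2 * (e + 1) ^ 3) =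
      K * (2 * e + 1 + 2 * (e * (e + 4)) + 2 * (e + 1) ^ 3) := by ring
    rw [this]
    refine Nat.mul_le_mul_left _ ?_
    nlinarith

lemma nearCommute_zpow_conj (ht : Near R K t (c * t')) (hc : NearCommute R K t' c)
    (hκ : NearCommute R K t' (t * x * t⁻¹ * x⁻¹)) (hκ' : NearCommute R K t' (t⁻¹ * x * t * x⁻¹))
    (hζc : NearCommute R K ζ c)
    (hζκ : NearCommute R K ζ (t * x * t⁻¹ * x⁻¹)) (hζκ' : NearCommute R K ζ (t⁻¹ * x * t * x⁻¹))
    (hζx : NearCommute R K ζ x) (e : ℤ) :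
    NearCommute R (K * (4 * (e.natAbs + 1) ^ 3)) ζ (t ^ e * x * (t ^ e)⁻¹) := by
  rcases Int.eq_nat_or_neg e with ⟨n, rfl | rfl⟩
  · simpa using (nearCommute_pow_conj ht hc hκ hζc hζκ hζx n).mono
      (Nat.mul_le_mul_left _ (by omega))
  · have ht' : Near R (2 * K) t⁻¹ (c⁻¹ * t'⁻¹) := by
      have h₁ := ht.inv
      rw [mul_inv_rev] at h₁
      exact (h₁.trans hc.inv_left.inv_right).mono (by omega)
    have hK : K ≤ 2 * K := by omega
    have h := nearCommute_pow_conj ht' (hc.inv_left.inv_right.mono hK)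
      (by rw [inv_inv]; exact hκ'.inv_left.mono hK) (hζc.inv_right.mono hK)
      (by rw [inv_inv]; exact hζκ'.mono hK) (hζx.mono hK) n
    simpa using h.mono (show _ ≤ K * (4 * (n + 1) ^ 3) by ring_nf; omega)

/-- Conjugation by a word in nearly commuting elements, all but one of which nearly commute with
`x`, is conjugation by a power of the remaining one. -/
lemma exists_near_zpow_conj {I : Type*} (τ : FreeGroup I →* FreeGroup Y) (i : I)
    (hττ : ∀ k, NearCommute R K (τ (.of k)) (τ (.of i)))
    (hτx : ∀ k, k ≠ i → NearCommute R K (τ (.of k)) x) (p : FreeGroup I) :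
    ∃ e : ℤ, e.natAbs ≤ fgNorm p ∧
      Near R (K * (fgNorm p * (2 * fgNorm p + 1))) (τ p * x * (τ p)⁻¹)
        (τ (.of i) ^ e * x * (τ (.of i) ^ e)⁻¹) := by
  refine FreeGroup.induction_fgNorm (P := fun p n => ∃ e : ℤ, e.natAbs ≤ n ∧
      Near R (K * (n * (2 * n + 1))) (τ p * x * (τ p)⁻¹)
        (τ (.of i) ^ e * x * (τ (.of i) ^ e)⁻¹)) ?_ ?_ ?_ p
  · exact ⟨0, le_rfl, Near.of_eq (by simp)⟩
  · rintro k w n - ⟨e, he, ih⟩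
    have h₁ := ih.conj (τ (.of k))
    have e₁ : τ (.of k * w) * x * (τ (.of k * w))⁻¹ =
        τ (.of k) * (τ w * x * (τ w)⁻¹) * (τ (.of k))⁻¹ := by
      rw [map_mul]; group
    rw [e₁]
    by_cases hk : k = i
    · subst hk
      refine ⟨e + 1, by omega, (h₁.trans (Near.of_eq (N := 0) ?_)).mono ?_⟩
      · rw [zpow_add_one, (Commute.refl _).zpow_left e |>.eq]; group
      · exact Nat.mul_le_mul_left _ (by nlinarith)
    · have h₂ := (((hττ k).zpow_right e).conj_right (hτx k hk)).near_conj
      refine ⟨e, by omega, (h₁.trans h₂).mono ?_⟩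
      have : 2 * (K * e.natAbs) + K ≤ K * (2 * n + 1) := by nlinarith
      calc _ ≤ K * (n * (2 * n + 1)) + K * (2 * n + 1) := by omega
        _ = K * ((n + 1) * (2 * n + 1)) := by ring
        _ ≤ _ := by gcongr; omega
  · rintro k w n - ⟨e, he, ih⟩
    have h₁ := ih.conj (τ (.of k))⁻¹
    have e₁ : τ ((.of k)⁻¹ * w) * x * (τ ((.of k)⁻¹ * w))⁻¹ =
        (τ (.of k))⁻¹ * (τ w * x * (τ w)⁻¹) * (τ (.of k))⁻¹⁻¹ := by
      rw [map_mul, map_inv]; group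
    rw [e₁]
    by_cases hk : k = i
    · subst hk
      refine ⟨e - 1, by omega, (h₁.trans (Near.of_eq (N := 0) ?_)).mono ?_⟩
      · rw [zpow_sub_one, ← ((Commute.refl (τ (.of k))).zpow_left e).inv_right.eq.symm]; group
      · exact Nat.mul_le_mul_left _ (by nlinarith)
    · have h₂ := (((hττ k).zpow_right e).conj_right (hτx k hk)).inv_left.near_conj
      refine ⟨e, by omega, (h₁.trans h₂).mono ?_⟩
      have : 2 * (K * e.natAbs) + K ≤ K * (2 * n + 1) := by nlinarith
      calc _ ≤ K * (n * (2 * n + 1)) + K * (2 * n + 1) := by omega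
        _ = K * ((n + 1) * (2 * n + 1)) := by ring
        _ ≤ _ := by gcongr; omega

lemma nearCommute_conj_word {I : Type*} (τ : FreeGroup I →* FreeGroup Y) (i : I)
    (hττ : ∀ k, NearCommute R K (τ (.of k)) (τ (.of i)))
    (hτx : ∀ k, k ≠ i → NearCommute R K (τ (.of k)) x)
    (ht : Near R K (τ (.of i)) (c * t')) (hc : NearCommute R K t' c)
    (hκ : NearCommute R K t' (τ (.of i) * x * (τ (.of i))⁻¹ * x⁻¹))
    (hκ' : NearCommute R K t' ((τ (.of i))⁻¹ * x * τ (.of i) * x⁻¹))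
    (hζc : NearCommute R K ζ c)
    (hζκ : NearCommute R K ζ (τ (.of i) * x * (τ (.of i))⁻¹ * x⁻¹))
    (hζκ' : NearCommute R K ζ ((τ (.of i))⁻¹ * x * τ (.of i) * x⁻¹))
    (hζx : NearCommute R K ζ x) (p : FreeGroup I) :
    NearCommute R (K * (8 * (fgNorm p + 1) ^ 3)) ζ (τ p * x * (τ p)⁻¹) := by
  obtain ⟨e, he, h⟩ := exists_near_zpow_conj τ i hττ hτx p
  refine ((nearCommute_zpow_conj ht hc hκ hκ' hζc hζκ hζκ' hζx e).congr_right h).mono ?_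
  generalize fgNorm p = n at *
  calc _ ≤ K * (4 * (n + 1) ^ 3) + 2 * (K * (n * (2 * n + 1))) := by gcongr
    _ = K * (4 * (n + 1) ^ 3 + 2 * (n * (2 * n + 1))) := by ring
    _ ≤ _ := by gcongr; nlinarith [Nat.zero_le (n ^ 3)]

end Commutation

/-! ### The isoperimetric inequality for a fibre product of split extensions -/

namespace FreeGroup

variable {X : Type*}

lemma induction_fgNorm_right {P : FreeGroup X → ℕ → Prop} (one : P 1 0)
    (mul_of : ∀ x w n, fgNorm w ≤ n → P w n → P (w * of x) (n + 1))
    (mul_inv_of : ∀ x w n, fgNorm w ≤ n → P w n → P (w * (of x)⁻¹) (n + 1))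
    (w : FreeGroup X) : P w (fgNorm w) := by
  have := induction_fgNorm (P := fun w n => P w⁻¹ n) (by simpa using one)
    (fun x w n hw h => by simpa using mul_inv_of x w⁻¹ n (by rwa [fgNorm_inv]) h)
    (fun x w n hw h => by simpa using mul_of x w⁻¹ n (by rwa [fgNorm_inv]) h) w⁻¹
  rwa [inv_inv, fgNorm_inv] at this

lemma exists_hom {G : Type*} [Group G] (f : X → G) :
    ∃ φ : FreeGroup X →* G, ∀ x, φ (of x) = f x :=
  ⟨lift f, fun _ => lift_apply_of ..⟩

end FreeGroup

open FreeGroup in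
lemma near_normalForm {I X Z : Type*} {R : Set (FreeGroup (I ⊕ (X ⊕ Z)))}
    (t : FreeGroup I →* FreeGroup (I ⊕ (X ⊕ Z))) (ht : ∀ k, t (of k) = of (.inl k))
    (α : FreeGroup (I ⊕ X) →* FreeGroup (I ⊕ (X ⊕ Z)))
    (hα : ∀ k, α (of (.inl k)) = of (.inl k)) (hα' : ∀ x, α (of (.inr x)) = of (.inr (.inl x)))
    (β : FreeGroup (I ⊕ Z) →* FreeGroup (I ⊕ (X ⊕ Z)))
    (hβ : ∀ k, β (of (.inl k)) = of (.inl k)) (hβ' : ∀ z, β (of (.inr z)) = of (.inr (.inr z)))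
    (iA : FreeGroup I →* FreeGroup (I ⊕ X)) (hiA : ∀ k, iA (of k) = of (.inl k))
    (iB : FreeGroup I →* FreeGroup (I ⊕ Z)) (hiB : ∀ k, iB (of k) = of (.inl k))
    (pX : X → FreeGroup I) (pZ : Z → FreeGroup I)
    (p : FreeGroup (I ⊕ (X ⊕ Z)) →* FreeGroup I) (hp : ∀ k, p (of (.inl k)) = of k)
    (hpX : ∀ x, p (of (.inr (.inl x))) = pX x) (hpZ : ∀ z, p (of (.inr (.inr z))) = pZ z)
    (ρA : FreeGroup (I ⊕ (X ⊕ Z)) →* FreeGroup (I ⊕ X)) (hρA : ∀ k, ρA (of (.inl k)) = of (.inl k))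
    (hρAX : ∀ x, ρA (of (.inr (.inl x))) = of (.inr x))
    (hρAZ : ∀ z, ρA (of (.inr (.inr z))) = iA (pZ z))
    (ρB : FreeGroup (I ⊕ (X ⊕ Z)) →* FreeGroup (I ⊕ Z)) (hρB : ∀ k, ρB (of (.inl k)) = of (.inl k))
    (hρBX : ∀ x, ρB (of (.inr (.inl x))) = iB (pX x))
    (hρBZ : ∀ z, ρB (of (.inr (.inr z))) = of (.inr z))
    {D : ℕ} (hD : ∀ w, fgNorm (p w) ≤ D * fgNorm w) (hDB : ∀ w, fgNorm (ρB w) ≤ D * fgNorm w)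
    (hcomm : ∀ x z (q : FreeGroup I), NearCommute R (8 * (fgNorm q + 1) ^ 3)
      ((t (pZ z))⁻¹ * of (.inr (.inr z)))
      (t q * (of (.inr (.inl x)) * (t (pX x))⁻¹) * (t q)⁻¹))
    (w : FreeGroup (I ⊕ (X ⊕ Z))) :
    Near R (fgNorm w * (8 * (D * (fgNorm w + 1)) * (D * (D * (fgNorm w + 1)) + 1) ^ 3)) w
      (α (ρA w) * (t (p w))⁻¹ * β (ρB w)) := by
  have hαiA : ∀ q, α (iA q) = t q := fun q => DFunLike.congr_fun
    (FreeGroup.ext_hom _ _ (by simp [hα, hiA, ht]) : α.comp iA = t) q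
  have hβiB : ∀ q, β (iB q) = t q := fun q => DFunLike.congr_fun
    (FreeGroup.ext_hom _ _ (by simp [hβ, hiB, ht]) : β.comp iB = t) q
  have hpt : ∀ q, p (t q) = q := fun q => DFunLike.congr_fun
    (FreeGroup.ext_hom _ _ (by simp [ht, hp]) : p.comp t = MonoidHom.id _) q
  have hpβρ : ∀ w, p (β (ρB w)) = p w := fun w => DFunLike.congr_fun
    (FreeGroup.ext_hom _ _ (by
      rintro (k | x | z)
      · simp [hρB, hβ]
      · simp [hρBX, hβiB, hpt, hpX]
      · simp [hρBZ, hβ']) : (p.comp β).comp ρB = p) w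
  have hDβ : ∀ u, fgNorm (β u) ≤ fgNorm u := by
    refine fun u => induction_fgNorm (P := fun u n => fgNorm (β u) ≤ n) ?_ ?_ ?_ u
    · simp [fgNorm_one]
    · rintro (k | z) u n - ih
      · have := fgNorm_mul_le (of (.inl k)) (β u)
        rw [fgNorm_of] at this
        rw [_root_.map_mul, hβ]
        omega
      · have := fgNorm_mul_le (of (.inr (.inr z))) (β u)
        rw [fgNorm_of] at this
        rw [_root_.map_mul, hβ']
        omega
    · rintro (k | z) u n - ih
      · have := fgNorm_mul_le (of (.inl k))⁻¹ (β u)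
        rw [fgNorm_inv, fgNorm_of] at this
        rw [_root_.map_mul, _root_.map_inv, hβ]
        omega
      · have := fgNorm_mul_le (of (.inr (.inr z)))⁻¹ (β u)
        rw [fgNorm_inv, fgNorm_of] at this
        rw [_root_.map_mul, _root_.map_inv, hβ']
        omega
  have inner : ∀ x u, Near R (8 * fgNorm u * (D * fgNorm u + 1) ^ 3)
      (β u * (of (.inr (.inl x)) * (t (pX x))⁻¹) * (β u)⁻¹)
      (t (p (β u)) * (of (.inr (.inl x)) * (t (pX x))⁻¹) * (t (p (β u)))⁻¹) := by
    intro x u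
    generalize hy : (of (.inr (.inl x)) * (t (pX x))⁻¹ : FreeGroup (I ⊕ (X ⊕ Z))) = y
    replace hcomm := hcomm x
    rw [hy] at hcomm
    refine induction_fgNorm (P := fun u n => Near R (8 * n * (D * n + 1) ^ 3)
      (β u * y * (β u)⁻¹) (t (p (β u)) * y * (t (p (β u)))⁻¹)) ?_ ?_ ?_ u
    · exact Near.of_eq (by simp)
    · intro a u n hu ih
      have hpu : fgNorm (p (β u)) ≤ D * n := (hD _).trans (Nat.mul_le_mul_left _ ((hDβ _).trans hu))
      have hle : 8 * n * (D * n + 1) ^ 3 ≤ 8 * n * (D * (n + 1) + 1) ^ 3 := by gcongr; omega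
      have h₁ := ih.conj (β (of a))
      rw [_root_.map_mul, _root_.map_mul, _root_.map_mul]
      refine Near.mono (Near.trans (Near.trans (Near.of_eq (N := 0) (by group)) h₁)
        (N := 8 * (D * (n + 1) + 1) ^ 3) ?_) (by nlinarith)
      rcases a with k | z
      · exact Near.of_eq (by rw [hβ, hp, ht]; group)
      · rw [hβ', hpZ]
        have h := ((hcomm z (p (β u))).near_conj.conj (t (pZ z))).mono
          (N := 8 * (D * (n + 1) + 1) ^ 3) (by gcongr; rw [mul_add]; omega)
        convert h using 1 <;> group
    · intro a u n hu ih
      have hpu : fgNorm (p ((β (of a))⁻¹ * β u)) ≤ D * (n + 1) := by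
        refine (hD _).trans (Nat.mul_le_mul_left _ ?_)
        rw [← _root_.map_inv, ← _root_.map_mul]
        refine (hDβ _).trans ((fgNorm_mul_le _ _).trans ?_)
        rw [fgNorm_inv, fgNorm_of]
        omega
      have hle : 8 * n * (D * n + 1) ^ 3 ≤ 8 * n * (D * (n + 1) + 1) ^ 3 := by gcongr; omega
      have h₁ := ih.conj (β (of a))⁻¹
      rw [_root_.map_mul, _root_.map_inv]
      refine Near.mono (Near.trans (Near.trans (Near.of_eq (N := 0) (by group)) h₁)
        (N := 8 * (D * (n + 1) + 1) ^ 3) ?_) (by nlinarith)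
      rcases a with k | z
      · exact Near.of_eq (by rw [_root_.map_mul, _root_.map_mul, hβ, _root_.map_inv, hp,
          _root_.map_inv, ht]; group)
      · rw [hβ'] at hpu ⊢
        have h := ((hcomm z _).near_conj.conj
          ((of (.inr (.inr z)))⁻¹ * t (pZ z))).symm.mono (N := 8 * (D * (n + 1) + 1) ^ 3)
          (Nat.mul_le_mul_left _ (Nat.pow_le_pow_left (Nat.add_le_add_right hpu 1) 3))
        rw [_root_.map_mul, _root_.map_inv, hpZ] at h ⊢
        rw [_root_.map_mul, _root_.map_inv] at h ⊢
        convert h using 1 <;> group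
  have hstep : ∀ w a, Near R (8 * (D * fgNorm w) * (D * (D * fgNorm w) + 1) ^ 3)
      (α (ρA w) * (t (p w))⁻¹ * β (ρB w) * of a)
      (α (ρA (w * of a)) * (t (p (w * of a)))⁻¹ * β (ρB (w * of a))) := by
    intro w a
    simp only [_root_.map_mul]
    rcases a with k | x | z
    · exact Near.of_eq (by rw [hρA, hρB, hα, hβ, hp, ht]; group)
    · have h := inner x (ρB w)
      rw [hpβρ] at h
      have h₁ := ((h.mul_left (α (ρA w) * (t (p w))⁻¹)).mul_right (β (ρB w) * t (pX x))).mono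
        (N := 8 * (D * fgNorm w) * (D * (D * fgNorm w) + 1) ^ 3) (by gcongr <;> exact hDB w)
      rw [hρAX, hρBX, hα', hβiB, hpX]
      convert h₁ using 1 <;> group
    · exact Near.of_eq (by rw [hρAZ, hρBZ, hαiA, hβ', hpZ]; group)
  refine induction_fgNorm_right (P := fun w n => ∀ l, n ≤ l →
    Near R (n * (8 * (D * (l + 1)) * (D * (D * (l + 1)) + 1) ^ 3)) w
      (α (ρA w) * (t (p w))⁻¹ * β (ρB w))) ?_ ?_ ?_ w _ le_rfl
  · exact fun _ _ => Near.of_eq (by simp)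
  · intro a w n hw ih l hl
    have h₁ := (ih l (by omega)).mul_right (of a)
    have h₂ := (hstep w a).mono (N := 8 * (D * (l + 1)) * (D * (D * (l + 1)) + 1) ^ 3)
      (by gcongr <;> omega)
    exact (h₁.trans h₂).mono (by rw [Nat.add_mul]; omega)
  · intro a w n hw ih l hl
    have h₁ := (ih l (by omega)).mul_right (of a)⁻¹
    have hn : fgNorm (w * (of a)⁻¹) ≤ l + 1 := by
      refine (fgNorm_mul_le _ _).trans ?_
      rw [fgNorm_inv, fgNorm_of]
      omega
    have h₂ := ((hstep (w * (of a)⁻¹) a).mono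
      (N := 8 * (D * (l + 1)) * (D * (D * (l + 1)) + 1) ^ 3)
      (by gcongr)).symm.mul_right (of a)⁻¹
    rw [inv_mul_cancel_right, mul_inv_cancel_right] at h₂
    exact (h₁.trans h₂).mono (by rw [Nat.add_mul]; omega)

/-- `φ` maps onto `G` with relators `R` holding in `G`, and words of length at most `l` that are
trivial in `G` are products of at most `f l` conjugates of relators. -/
structure Fills {X G : Type*} [Group G] (φ : FreeGroup X →* G) (R : Set (FreeGroup X))
    (f : ℕ → ℕ) : Prop where
  surjective : Function.Surjective φ
  finite : R.Finite
  map_eq_one : ∀ r ∈ R, φ r = 1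
  areaLE : ∀ w l, φ w = 1 → fgNorm w ≤ l → AreaLE R w (f l)

open FreeGroup in
/-- The isoperimetric inequality for the fibre product of two split epimorphisms onto an abelian
group, under a commutation hypothesis on generators of the first factor. -/
theorem exists_fills_fibreProduct {I X Z : Type*} [Finite I] [Finite X] [Finite Z]
    {A B T G : Type*} [Group A] [Group B] [CommGroup T] [Group G]
    {ε : I → T} (hε : Function.Surjective (FreeGroup.lift ε))
    {sA : T →* A} {sB : T →* B} {θA : A →* T} {θB : B →* T}
    (hsA : ∀ v, θA (sA v) = v) (hsB : ∀ v, θB (sB v) = v) {gX : X → A} {gZ : Z → B}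
    (hgX : ∀ x, ∃ i, (∀ k, k ≠ i → Commute (sA (ε k)) (gX x)) ∧
      ∃ a, θA a = ε i ∧ Commute a (gX x) ∧ Commute a (sA (ε i)))
    {pA : G →* A} {pB : G →* B} (hinj : ∀ g, pA g = 1 → pB g = 1 → g = 1)
    (hrange : ∀ g, θA (pA g) = θB (pB g))
    (hsurj : ∀ a b, θA a = θB b → ∃ g, pA g = a ∧ pB g = b)
    {RA : Set (FreeGroup (I ⊕ X))} {RB : Set (FreeGroup (I ⊕ Z))} {fA fB : ℕ → ℕ}
    (hA : Fills (FreeGroup.lift (Sum.elim (fun k => sA (ε k)) gX)) RA fA)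
    (hB : Fills (FreeGroup.lift (Sum.elim (fun k => sB (ε k)) gZ)) RB fB) :
    ∃ (π : FreeGroup (I ⊕ (X ⊕ Z)) →* G) (R : Set (FreeGroup (I ⊕ (X ⊕ Z)))) (C : ℕ),
      Fills π R (fun l => 2 * fA (C * l) + fB (C * l) + C * (l + 1) ^ 5) := by
  obtain ⟨φA, hφA⟩ : ∃ φA, φA = FreeGroup.lift (Sum.elim (fun k => sA (ε k)) gX) := ⟨_, rfl⟩
  obtain ⟨φB, hφB⟩ : ∃ φB, φB = FreeGroup.lift (Sum.elim (fun k => sB (ε k)) gZ) := ⟨_, rfl⟩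
  rw [← hφA] at hA
  rw [← hφB] at hB
  have hφAI : ∀ k, φA (of (.inl k)) = sA (ε k) := by simp [hφA]
  have hφAX : ∀ x, φA (of (.inr x)) = gX x := by simp [hφA]
  have hφBI : ∀ k, φB (of (.inl k)) = sB (ε k) := by simp [hφB]
  have hφBZ : ∀ z, φB (of (.inr z)) = gZ z := by simp [hφB]
  have hinj' : ∀ g h, pA g = pA h → pB g = pB h → g = h := by
    intro g h h₁ h₂
    rw [← mul_inv_eq_one]
    exact hinj _ (by simp [h₁]) (by simp [h₂])
  choose pX hpX using fun x => hε (θA (gX x))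
  choose pZ hpZ using fun z => hε (θB (gZ z))
  obtain ⟨t, ht⟩ := exists_hom fun k : I => of (Sum.inl k : I ⊕ (X ⊕ Z))
  obtain ⟨iA, hiA⟩ := exists_hom fun k : I => of (Sum.inl k : I ⊕ X)
  obtain ⟨iB, hiB⟩ := exists_hom fun k : I => of (Sum.inl k : I ⊕ Z)
  obtain ⟨α, hα⟩ := exists_hom (Sum.elim (fun k : I => of (Sum.inl k : I ⊕ (X ⊕ Z)))
    fun x => of (Sum.inr (Sum.inl x)))
  obtain ⟨β, hβ⟩ := exists_hom (Sum.elim (fun k : I => of (Sum.inl k : I ⊕ (X ⊕ Z)))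
    fun z => of (Sum.inr (Sum.inr z)))
  obtain ⟨p, hp⟩ := exists_hom (Sum.elim (fun k : I => of k) (Sum.elim pX pZ))
  obtain ⟨ρA, hρA⟩ := exists_hom (Sum.elim (fun k : I => of (Sum.inl k))
    (Sum.elim (fun x : X => of (Sum.inr x)) fun z => iA (pZ z)))
  obtain ⟨ρB, hρB⟩ := exists_hom (Sum.elim (fun k : I => of (Sum.inl k))
    (Sum.elim (fun x : X => iB (pX x)) fun z : Z => of (Sum.inr z)))
  choose γI hγIA hγIB using fun k => hsurj (sA (ε k)) (sB (ε k)) (by rw [hsA, hsB])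
  choose γX hγXA hγXB using fun x => hsurj (gX x) (sB (θA (gX x))) (by rw [hsB])
  choose γZ hγZA hγZB using fun z => hsurj (sA (θB (gZ z))) (gZ z) (by rw [hsA])
  obtain ⟨π, hπ⟩ := exists_hom (Sum.elim γI (Sum.elim γX γZ))
  -- compatibility of the homomorphisms
  have hφAiA : ∀ q, φA (iA q) = sA (lift ε q) := fun q => DFunLike.congr_fun
    (FreeGroup.ext_hom _ _ (by simp [hiA, hφAI]) : φA.comp iA = sA.comp (lift ε)) q
  have hφBiB : ∀ q, φB (iB q) = sB (lift ε q) := fun q => DFunLike.congr_fun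
    (FreeGroup.ext_hom _ _ (by simp [hiB, hφBI]) : φB.comp iB = sB.comp (lift ε)) q
  have hαiA : ∀ q, α (iA q) = t q := fun q => DFunLike.congr_fun
    (FreeGroup.ext_hom _ _ (by simp [hα, hiA, ht]) : α.comp iA = t) q
  have hπA : ∀ w, pA (π w) = φA (ρA w) := fun w => DFunLike.congr_fun
    (FreeGroup.ext_hom _ _ (by
      rintro (k | x | z)
      · simp [hπ, hρA, hφAI, hγIA]
      · simp [hπ, hρA, hφAX, hγXA]
      · simp [hπ, hρA, hφAiA, hγZA, hpZ]) : pA.comp π = φA.comp ρA) w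
  have hπB : ∀ w, pB (π w) = φB (ρB w) := fun w => DFunLike.congr_fun
    (FreeGroup.ext_hom _ _ (by
      rintro (k | x | z)
      · simp [hπ, hρB, hφBI, hγIB]
      · simp [hπ, hρB, hφBiB, hγXB, hpX]
      · simp [hπ, hρB, hφBZ, hγZB]) : pB.comp π = φB.comp ρB) w
  have hθp : ∀ w, θA (pA (π w)) = lift ε (p w) := fun w => DFunLike.congr_fun
    (FreeGroup.ext_hom _ _ (by
      rintro (k | x | z)
      · simp [hπ, hp, hγIA, hsA]
      · simp [hπ, hp, hγXA, hpX]
      · simp [hπ, hp, hγZA, hpZ, hsA]) : (θA.comp pA).comp π = (lift ε).comp p) w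
  have hαA : ∀ u, pA (π (α u)) = φA u := fun u => DFunLike.congr_fun
    (FreeGroup.ext_hom _ _ (by
      rintro (k | x)
      · simp [hπ, hα, hφAI, hγIA]
      · simp [hπ, hα, hφAX, hγXA]) : (pA.comp π).comp α = φA) u
  have hαB : ∀ u, pB (π (α u)) = sB (θA (φA u)) := fun u => DFunLike.congr_fun
    (FreeGroup.ext_hom _ _ (by
      rintro (k | x)
      · simp [hπ, hα, hφAI, hγIB, hsA]
      · simp [hπ, hα, hφAX, hγXB]) : (pB.comp π).comp α = (sB.comp θA).comp φA) u
  have hβA : ∀ u, pA (π (β u)) = sA (θB (φB u)) := fun u => DFunLike.congr_fun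
    (FreeGroup.ext_hom _ _ (by
      rintro (k | x)
      · simp [hπ, hβ, hφBI, hγIA, hsB]
      · simp [hπ, hβ, hφBZ, hγZA]) : (pA.comp π).comp β = (sA.comp θB).comp φB) u
  have hβB : ∀ u, pB (π (β u)) = φB u := fun u => DFunLike.congr_fun
    (FreeGroup.ext_hom _ _ (by
      rintro (k | x)
      · simp [hπ, hβ, hφBI, hγIB]
      · simp [hπ, hβ, hφBZ, hγZB]) : (pB.comp π).comp β = φB) u
  have htA : ∀ q, pA (π (t q)) = sA (lift ε q) := fun q => by rw [← hαiA, hαA, hφAiA]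
  have htB : ∀ q, pB (π (t q)) = sB (lift ε q) := fun q => by
    rw [← hαiA, hαB, hφAiA, hsA]
  have hπsurj : Function.Surjective π := by
    intro g
    obtain ⟨w₁, h₁⟩ := hA.surjective (pA g)
    obtain ⟨w₂, h₂⟩ := hB.surjective (pB g)
    obtain ⟨q, hq⟩ := hε (θA (pA g))
    refine ⟨α w₁ * (t q)⁻¹ * β w₂, hinj' _ _ ?_ ?_⟩
    · simp only [_root_.map_mul, _root_.map_inv, hαA, htA, hβA, h₁, h₂, hq, hrange]
      group
    · simp only [_root_.map_mul, _root_.map_inv, hαB, htB, hβB, h₁, h₂, hq, hrange]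
      group
  -- the auxiliary words
  choose i hi a ha hax hai using hgX
  have hlift : ∀ a b, θA a = θB b → ∃ w, pA (π w) = a ∧ pB (π w) = b := by
    intro a b hab
    obtain ⟨g, hgA, hgB⟩ := hsurj a b hab
    obtain ⟨w, rfl⟩ := hπsurj g
    exact ⟨w, hgA, hgB⟩
  choose c hcA hcB using fun x => hlift (sA (ε (i x)) * (a x)⁻¹) 1 (by simp [hsA, ha])
  choose t' ht'A ht'B using fun x => hlift (a x) (sB (ε (i x))) (by simp [hsB, ha])
  obtain ⟨xb, hxb⟩ : ∃ xb : X → FreeGroup (I ⊕ (X ⊕ Z)),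
    ∀ x, of (.inr (.inl x)) * (t (pX x))⁻¹ = xb x := ⟨_, fun _ => rfl⟩
  obtain ⟨ζ, hζ⟩ : ∃ ζ : Z → FreeGroup (I ⊕ (X ⊕ Z)),
    ∀ z, (t (pZ z))⁻¹ * of (.inr (.inr z)) = ζ z := ⟨_, fun _ => rfl⟩
  have hxbA : ∀ x, pA (π (xb x)) = gX x * (sA (θA (gX x)))⁻¹ := fun x => by
    simp [← hxb, htA, hπ, hγXA, hpX]
  have hxbB : ∀ x, pB (π (xb x)) = 1 := fun x => by
    simp [← hxb, htB, hπ, hγXB, hpX]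
  have hζA : ∀ z, pA (π (ζ z)) = 1 := fun z => by
    simp [← hζ, htA, hπ, hγZA, hpZ]
  obtain ⟨κ, hκ⟩ : ∃ κ : X → FreeGroup (I ⊕ (X ⊕ Z)),
    ∀ x, t (of (i x)) * xb x * (t (of (i x)))⁻¹ * (xb x)⁻¹ = κ x := ⟨_, fun _ => rfl⟩
  obtain ⟨κ', hκ'⟩ : ∃ κ' : X → FreeGroup (I ⊕ (X ⊕ Z)),
    ∀ x, (t (of (i x)))⁻¹ * xb x * t (of (i x)) * (xb x)⁻¹ = κ' x := ⟨_, fun _ => rfl⟩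
  have hsAcomm : ∀ u v, Commute (sA u) (sA v) := fun u v => (Commute.all u v).map sA
  have hsBcomm : ∀ u v, Commute (sB u) (sB v) := fun u v => (Commute.all u v).map sB
  have hκA : ∀ x, Commute (a x) (pA (π (κ x))) := fun x => by
    have : pA (π (κ x)) = sA (ε (i x)) * gX x * (sA (ε (i x)))⁻¹ * (gX x)⁻¹ := by
      have h := (hsAcomm (θA (gX x)) (ε (i x))).inv_left.inv_right.eq
      simp only [← hκ, _root_.map_mul, _root_.map_inv, htA, hxbA, lift_apply_of]
      simp only [mul_assoc, mul_inv_rev, inv_inv, mul_left_cancel_iff]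
      rw [← mul_assoc, h]
      group
    rw [this]
    exact (((hai x).mul_right (hax x)).mul_right (hai x).inv_right).mul_right (hax x).inv_right
  have hκ'A : ∀ x, Commute (a x) (pA (π (κ' x))) := fun x => by
    have : pA (π (κ' x)) = (sA (ε (i x)))⁻¹ * gX x * sA (ε (i x)) * (gX x)⁻¹ := by
      have h := (hsAcomm (θA (gX x)) (ε (i x))).inv_left.eq
      simp only [← hκ', _root_.map_mul, _root_.map_inv, htA, hxbA, lift_apply_of]
      simp only [mul_assoc, mul_inv_rev, inv_inv, mul_left_cancel_iff]
      rw [← mul_assoc, h]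
      group
    rw [this]
    exact (((hai x).inv_right.mul_right (hax x)).mul_right (hai x)).mul_right (hax x).inv_right
  have hκB : ∀ x, pB (π (κ x)) = 1 := fun x => by simp [← hκ, hxbB]
  have hκ'B : ∀ x, pB (π (κ' x)) = 1 := fun x => by simp [← hκ', hxbB]
  -- the relators
  let W : Set (FreeGroup (I ⊕ (X ⊕ Z))) := Set.range (fun k => t (of k)) ∪ Set.range c ∪
    Set.range t' ∪ Set.range xb ∪ Set.range ζ ∪ Set.range κ ∪ Set.range κ'
  have hW : W.Finite := by
    refine Set.Finite.union (Set.Finite.union (Set.Finite.union (Set.Finite.union (Set.Finite.union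
      (Set.Finite.union ?_ ?_) ?_) ?_) ?_) ?_) ?_ <;> exact Set.finite_range _
  let S : Set (FreeGroup (I ⊕ (X ⊕ Z))) :=
    {r | (∃ u ∈ W, ∃ v ∈ W, u * v * (v * u)⁻¹ = r) ∧ π r = 1}
  let R := α '' RA ∪ β '' RB ∪ S ∪ Set.range fun x => t (of (i x)) * (c x * t' x)⁻¹
  have hRfin : R.Finite := by
    refine (((hA.finite.image α).union (hB.finite.image β)).union ?_).union (Set.finite_range _)
    refine (Set.Finite.image2 (fun u v => u * v * (v * u)⁻¹) hW hW).subset ?_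
    rintro r ⟨⟨u, hu, v, hv, rfl⟩, -⟩
    exact ⟨u, hu, v, hv, rfl⟩
  have hR1 : ∀ r ∈ R, π r = 1 := by
    rintro r (((⟨u, hu, rfl⟩ | ⟨u, hu, rfl⟩) | hr) | ⟨x, rfl⟩)
    · exact hinj _ (by rw [hαA, hA.map_eq_one u hu]) (by rw [hαB, hA.map_eq_one u hu]; simp)
    · exact hinj _ (by rw [hβA, hB.map_eq_one u hu]; simp) (by rw [hβB, hB.map_eq_one u hu])
    · exact hr.2
    · exact hinj _ (by simp [htA, hcA, ht'A]) (by simp [htB, hcB, ht'B])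
  have hcommR : ∀ u ∈ W, ∀ v ∈ W, Commute (pA (π u)) (pA (π v)) →
      Commute (pB (π u)) (pB (π v)) → NearCommute R 1 u v := by
    intro u hu v hv h₁ h₂
    refine AreaLE.of_mem (Or.inl (Or.inr ⟨⟨u, hu, v, hv, rfl⟩, hinj _ ?_ ?_⟩))
    · simpa [mul_assoc, mul_inv_eq_one, ← mul_inv_rev] using mul_inv_eq_one.2 h₁.eq
    · simpa [mul_assoc, mul_inv_eq_one, ← mul_inv_rev] using mul_inv_eq_one.2 h₂.eq
  have htW : ∀ k, t (of k) ∈ W := fun k => by simp [W]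
  have hcW : ∀ x, c x ∈ W := fun x => by simp [W]
  have ht'W : ∀ x, t' x ∈ W := fun x => by simp [W]
  have hxbW : ∀ x, xb x ∈ W := fun x => by simp [W]
  have hζW : ∀ z, ζ z ∈ W := fun z => by simp [W]
  have hκW : ∀ x, κ x ∈ W := fun x => by simp [W]
  have hκ'W : ∀ x, κ' x ∈ W := fun x => by simp [W]
  have hcomm : ∀ x z (q : FreeGroup I), NearCommute R (8 * (fgNorm q + 1) ^ 3)
      ((t (pZ z))⁻¹ * of (.inr (.inr z)))
      (t q * (of (.inr (.inl x)) * (t (pX x))⁻¹) * (t q)⁻¹) := by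
    intro x z q
    rw [hxb, hζ]
    have h := nearCommute_conj_word (R := R) (K := 1) (x := xb x) (ζ := ζ z) (c := c x)
      (t' := t' x) t (i x) ?_ ?_ ?_ ?_ ?_ ?_ ?_ ?_ ?_ ?_ q
    · rwa [one_mul] at h
    · exact fun k => hcommR _ (htW _) _ (htW _) (by rw [htA, htA]; exact hsAcomm _ _)
        (by rw [htB, htB]; exact hsBcomm _ _)
    · intro k hk
      refine hcommR _ (htW _) _ (hxbW _) ?_ (by simp [hxbB])
      rw [htA, hxbA, lift_apply_of]
      exact (hi x k hk).mul_right (hsAcomm _ _).inv_right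
    · exact AreaLE.of_mem (Or.inr ⟨x, rfl⟩)
    · refine hcommR _ (ht'W _) _ (hcW _) ?_ (by simp [hcB])
      rw [ht'A, hcA]
      exact (hai x).mul_right (Commute.refl _).inv_right
    · rw [hκ]
      exact hcommR _ (ht'W _) _ (hκW _) (by rw [ht'A]; exact hκA x) (by simp [hκB])
    · rw [hκ']
      exact hcommR _ (ht'W _) _ (hκ'W _) (by rw [ht'A]; exact hκ'A x) (by simp [hκ'B])
    · exact hcommR _ (hζW _) _ (hcW _) (by simp [hζA]) (by simp [hcB])
    · rw [hκ]
      exact hcommR _ (hζW _) _ (hκW _) (by simp [hζA]) (by simp [hκB])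
    · rw [hκ']
      exact hcommR _ (hζW _) _ (hκ'W _) (by simp [hζA]) (by simp [hκ'B])
    · exact hcommR _ (hζW _) _ (hxbW _) (by simp [hζA]) (by simp [hxbB])
  -- length bounds
  obtain ⟨D₁, hD₁⟩ := fgNorm_map_le p
  obtain ⟨D₂, hD₂⟩ := fgNorm_map_le ρA
  obtain ⟨D₃, hD₃⟩ := fgNorm_map_le ρB
  obtain ⟨D₄, hD₄⟩ := fgNorm_map_le (iA.comp p)
  obtain ⟨D, hDdef⟩ : ∃ D, D = D₁ + D₂ + D₃ + D₄ + 1 := ⟨_, rfl⟩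
  have hnf := near_normalForm (R := R) t ht α (fun k => by simp [hα]) (fun x => by simp [hα])
    β (fun k => by simp [hβ]) (fun x => by simp [hβ]) iA hiA iB hiB pX pZ p (fun k => by simp [hp])
    (fun x => by simp [hp]) (fun z => by simp [hp]) ρA (fun k => by simp [hρA])
    (fun x => by simp [hρA]) (fun z => by simp [hρA]) ρB (fun k => by simp [hρB])
    (fun x => by simp [hρB]) (fun z => by simp [hρB])
    (D := D) (fun w => (hD₁ w).trans (Nat.mul_le_mul_right _ (by omega)))
    (fun w => (hD₃ w).trans (Nat.mul_le_mul_right _ (by omega))) hcomm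
  refine ⟨π, R, 8 * D * (D * D + 1) ^ 3, hπsurj, hRfin, hR1, ?_⟩
  intro w l hw hl
  have hD1 : 1 ≤ D := by omega
  have hDC : D ≤ 8 * D * (D * D + 1) ^ 3 := by
    have : 1 ≤ (D * D + 1) ^ 3 := Nat.one_le_pow _ _ (by omega)
    nlinarith
  have hlen : ∀ {E n}, E ≤ D → n ≤ E * fgNorm w → n ≤ 8 * D * (D * D + 1) ^ 3 * l :=
    fun hE hn => hn.trans (Nat.mul_le_mul (hE.trans hDC) hl)
  have h₁ := (hA.areaLE (ρA w) _ (by rw [← hπA, hw, _root_.map_one])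
    (hlen (by omega) (hD₂ w))).map α (S := R) (K := 1)
    fun r hr => AreaLE.of_mem (Or.inl (Or.inl (Or.inl ⟨r, hr, rfl⟩)))
  have h₂ := (hA.areaLE (iA (p w)) _
    (by rw [hφAiA, ← hθp, hw, _root_.map_one, _root_.map_one, _root_.map_one])
    (hlen (by omega) (hD₄ w))).map α (S := R) (K := 1)
    fun r hr => AreaLE.of_mem (Or.inl (Or.inl (Or.inl ⟨r, hr, rfl⟩)))
  have h₃ := (hB.areaLE (ρB w) _ (by rw [← hπB, hw, _root_.map_one])
    (hlen (by omega) (hD₃ w))).map β (S := R) (K := 1)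
    fun r hr => AreaLE.of_mem (Or.inl (Or.inl (Or.inr ⟨r, hr, rfl⟩)))
  rw [hαiA] at h₂
  refine ((hnf w).areaLE ((h₁.mul h₂.inv).mul h₃)).mono ?_
  have key : fgNorm w * (8 * (D * (fgNorm w + 1)) * (D * (D * (fgNorm w + 1)) + 1) ^ 3) ≤
      8 * D * (D * D + 1) ^ 3 * (l + 1) ^ 5 := by
    calc _ ≤ (l + 1) * (8 * (D * (l + 1)) * ((D * D + 1) * (l + 1)) ^ 3) := by
          gcongr
          · omega
          · nlinarith
      _ = _ := by ring
  omega

/-! ### Rewriting words over a finite-index subgroup -/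

open FreeGroup in
/-- Every function of the generators extends to a cocycle on the free group. -/
lemma exists_cocycle {X Y T G : Type*} [Group G] [MulAction G T] (φ : FreeGroup X →* G)
    (y : X → T → FreeGroup Y) :
    ∃ ρ : FreeGroup X → T → FreeGroup Y, (∀ x τ, ρ (of x) τ = y x τ) ∧
      ∀ v w τ, ρ (v * w) τ = ρ v (φ w • τ) * ρ w τ := by
  let e : X → Equiv.Perm (T × FreeGroup Y) := fun x =>
    { toFun := fun p => (φ (of x) • p.1, y x p.1 * p.2)
      invFun := fun p => ((φ (of x))⁻¹ • p.1, (y x ((φ (of x))⁻¹ • p.1))⁻¹ * p.2)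
      left_inv := fun p => by simp
      right_inv := fun p => by simp }
  obtain ⟨Φ, hΦ⟩ := exists_hom e
  have key : ∀ w τ u, Φ w (τ, u) = (φ w • τ, (Φ w (τ, 1)).2 * u) := by
    intro w
    induction w using FreeGroup.induction_on with
    | C1 => simp
    | of x => intro τ u; simp [hΦ, e]
    | inv_of x ih => intro τ u; simp [hΦ, e]
    | mul v w hv hw =>
      intro τ u
      rw [_root_.map_mul, _root_.map_mul, Equiv.Perm.mul_apply, Equiv.Perm.mul_apply, hw τ u,
        hv _ (_ * u), hw τ 1, hv _ (_ * 1)]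
      simp [mul_smul, mul_assoc]
  refine ⟨fun w τ => (Φ w (τ, 1)).2, fun x τ => by simp [hΦ, e], fun v w τ => ?_⟩
  beta_reduce
  rw [_root_.map_mul, Equiv.Perm.mul_apply, key w τ 1, key v]

section Cocycle

variable {X Y T G : Type*} [Group G] [MulAction G T] {φ : FreeGroup X →* G}
  {ρ : FreeGroup X → T → FreeGroup Y}

lemma cocycle_one (hρ : ∀ v w τ, ρ (v * w) τ = ρ v (φ w • τ) * ρ w τ)
    (τ : T) : ρ 1 τ = 1 := by
  simpa using hρ 1 1 τ

lemma cocycle_inv (hρ : ∀ v w τ, ρ (v * w) τ = ρ v (φ w • τ) * ρ w τ)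
    (w : FreeGroup X) (τ : T) : ρ w⁻¹ τ = (ρ w (φ w⁻¹ • τ))⁻¹ := by
  have := hρ w w⁻¹ τ
  rw [mul_inv_cancel, cocycle_one hρ] at this
  exact eq_inv_of_mul_eq_one_right this.symm

lemma fgNorm_cocycle_le (hρ : ∀ v w τ, ρ (v * w) τ = ρ v (φ w • τ) * ρ w τ)
    {C : ℕ} (hC : ∀ x τ, fgNorm (ρ (.of x) τ) ≤ C) (w : FreeGroup X) (τ : T) :
    fgNorm (ρ w τ) ≤ C * fgNorm w := by
  refine FreeGroup.induction_fgNorm (P := fun w n => ∀ τ, fgNorm (ρ w τ) ≤ C * n) ?_ ?_ ?_ w τ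
  · simp [cocycle_one hρ, FreeGroup.fgNorm_one]
  · intro x w n _ ih τ
    rw [hρ, mul_add_one, add_comm]
    exact (FreeGroup.fgNorm_mul_le _ _).trans (add_le_add (hC _ _) (ih τ))
  · intro x w n _ ih τ
    rw [hρ, mul_add_one, add_comm, cocycle_inv hρ]
    refine (FreeGroup.fgNorm_mul_le _ _).trans (add_le_add ?_ (ih τ))
    rw [FreeGroup.fgNorm_inv]
    exact hC _ _

lemma AreaLE.cocycle (hρ : ∀ v w τ, ρ (v * w) τ = ρ v (φ w • τ) * ρ w τ)
    {R : Set (FreeGroup X)} (hR : ∀ r ∈ R, φ r = 1) {S : Set (FreeGroup Y)}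
    (hS : ∀ r ∈ R, ∀ τ, ρ r τ ∈ S) {w : FreeGroup X} {N : ℕ} (h : AreaLE R w N) (τ : T) :
    AreaLE S (ρ w τ) N := by
  refine AreaLE.induction (P := fun w n => ∀ τ, AreaLE S (ρ w τ) n) ?_ ?_ ?_ ?_ h τ
  · exact fun τ => by rw [cocycle_one hρ]; exact AreaLE.one _ _
  · intro g r w n hr ih τ
    have := ((AreaLE.of_mem (hS r hr (φ g⁻¹ • φ w • τ))).conj (ρ g (φ g⁻¹ • φ w • τ))).mul (ih τ)
    simp only [hρ, cocycle_inv hρ g, hR r hr, one_smul]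
    exact this.mono (by omega)
  · intro g r w n hr ih τ
    have := ((AreaLE.of_mem_inv (hS r hr (φ g⁻¹ • φ w • τ))).conj
      (ρ g (φ g⁻¹ • φ w • τ))).mul (ih τ)
    simp only [hρ, cocycle_inv hρ g, cocycle_inv hρ r, map_inv, hR r hr, one_smul, inv_one] at this ⊢
    exact this.mono (by omega)
  · exact fun w m n hmn h τ => (h τ).mono hmn

lemma cocycle_eq (hρ : ∀ v w τ, ρ (v * w) τ = ρ v (φ w • τ) * ρ w τ)
    {θ : FreeGroup Y →* G} {s : T → G}
    (h : ∀ x τ, s (φ (.of x) • τ) * θ (ρ (.of x) τ) = φ (.of x) * s τ) (w : FreeGroup X) (τ : T) :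
    s (φ w • τ) * θ (ρ w τ) = φ w * s τ := by
  induction w using FreeGroup.induction_on generalizing τ with
  | C1 => simp [cocycle_one hρ]
  | of x => exact h x τ
  | inv_of x ih =>
    have := h x (φ (.of x)⁻¹ • τ)
    simp only [map_inv, cocycle_inv hρ, smul_inv_smul] at this ⊢
    rw [mul_inv_eq_iff_eq_mul, mul_assoc, eq_inv_mul_iff_mul_eq, this]
  | mul v w hv hw =>
    rw [hρ, map_mul, map_mul, mul_smul, ← mul_assoc, hv, mul_assoc, hw, mul_assoc]

lemma near_cocycle (hρ : ∀ v w τ, ρ (v * w) τ = ρ v (φ w • τ) * ρ w τ)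
    {R : Set (FreeGroup X)} {j : FreeGroup Y →* FreeGroup X}
    {σ : T → FreeGroup X}
    (h : ∀ x τ, Near R 1 (.of x * σ τ) (σ (φ (.of x) • τ) * j (ρ (.of x) τ)))
    (w : FreeGroup X) (τ : T) : Near R (fgNorm w) (w * σ τ) (σ (φ w • τ) * j (ρ w τ)) := by
  refine FreeGroup.induction_fgNorm
    (P := fun w n => ∀ τ, Near R n (w * σ τ) (σ (φ w • τ) * j (ρ w τ))) ?_ ?_ ?_ w τ
  · exact fun τ => Near.of_eq (by simp [cocycle_one hρ])
  · intro x w n _ ih τ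
    have h₁ := (ih τ).mul_left (.of x)
    have h₂ := (h x (φ w • τ)).mul_right (j (ρ w τ))
    rw [← mul_assoc, ← mul_assoc] at h₁
    simpa [hρ, mul_smul, mul_assoc] using h₁.trans h₂
  · intro x w n _ ih τ
    have h₁ := (ih τ).mul_left (.of x)⁻¹
    have h₂ := (((h x (φ (.of x)⁻¹ • φ w • τ)).mul_left (.of x)⁻¹).mul_right
      (j (ρ (.of x) (φ (.of x)⁻¹ • φ w • τ)))⁻¹).symm.mul_right (j (ρ w τ))
    rw [← mul_assoc, ← mul_assoc] at h₁
    simp only [map_inv, smul_inv_smul, inv_mul_cancel_left, mul_assoc, mul_inv_cancel, mul_one,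
      map_mul] at h₁ h₂ ⊢
    simpa [hρ, cocycle_inv hρ, mul_smul, mul_assoc] using h₁.trans h₂

end Cocycle

/-- A finite system of coset data for rewriting over a finite-index subgroup. -/
lemma exists_rewriting {X Y G G' : Type*} [Finite X] [Group G] [Group G'] {ι : G' →* G}
    (hfin : ι.range.FiniteIndex) (φ : FreeGroup X →* G)
    {ψ : FreeGroup Y →* G'} (hψ : Function.Surjective ψ) :
    ∃ (ρ : FreeGroup X → G ⧸ ι.range → FreeGroup Y) (s : G ⧸ ι.range → G) (C : ℕ),
      (∀ v w τ, ρ (v * w) τ = ρ v (φ w • τ) * ρ w τ) ∧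
      (∀ w τ, s (φ w • τ) * ι (ψ (ρ w τ)) = φ w * s τ) ∧
      (∀ w τ, fgNorm (ρ w τ) ≤ C * fgNorm w) ∧ ∀ τ, (s τ : G ⧸ ι.range) = τ := by
  have : Finite (G ⧸ ι.range) := Subgroup.finite_quotient_of_finiteIndex
  have hy : ∀ x (τ : G ⧸ ι.range), ∃ u : FreeGroup Y,
      ι (ψ u) = (φ (.of x) • τ).out⁻¹ * (φ (.of x) * τ.out) := by
    intro x τ
    obtain ⟨g, hg⟩ : (φ (.of x) • τ).out⁻¹ * (φ (.of x) * τ.out) ∈ ι.range := by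
      rw [← QuotientGroup.eq, QuotientGroup.out_eq', ← smul_eq_mul,
        MulAction.Quotient.mk_smul_out]
    obtain ⟨u, rfl⟩ := hψ g
    exact ⟨u, hg⟩
  choose y hy using hy
  obtain ⟨ρ, hρ, hρmul⟩ := exists_cocycle φ y
  obtain ⟨C, hC⟩ := (Set.finite_range fun p : X × (G ⧸ ι.range) => fgNorm (y p.1 p.2)).bddAbove
  refine ⟨ρ, Quotient.out, C, hρmul, ?_, ?_, fun τ => QuotientGroup.out_eq' τ⟩
  · exact cocycle_eq hρmul (θ := ι.comp ψ) fun x τ => by simp [hρ, hy]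
  · exact fgNorm_cocycle_le hρmul fun x τ => by rw [hρ]; exact hC ⟨(x, τ), rfl⟩

open FreeGroup in
/-- Filling bounds pass to finite-index subgroups. -/
theorem Fills.of_finiteIndex {X Y G G' : Type*} [Finite X] [Finite Y] [Group G] [Group G']
    {ι : G' →* G} (hι : Function.Injective ι) (hfin : ι.range.FiniteIndex)
    {φ : FreeGroup X →* G} {R : Set (FreeGroup X)} {f : ℕ → ℕ} (h : Fills φ R f)
    {ψ : FreeGroup Y →* G'} (hψ : Function.Surjective ψ) :
    ∃ (S : Set (FreeGroup Y)) (C : ℕ), Fills ψ S fun l => f (C * l) + l := by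
  have : Finite (G ⧸ ι.range) := Subgroup.finite_quotient_of_finiteIndex
  obtain ⟨ρ, s, -, hρ, hs, -, hsmk⟩ := exists_rewriting hfin φ hψ
  choose u hu using fun y => h.surjective (ι (ψ (of y)))
  obtain ⟨j, hj⟩ := exists_hom u
  have hφj : ∀ w, φ (j w) = ι (ψ w) := fun w => DFunLike.congr_fun
    (FreeGroup.ext_hom _ _ (by simp [hj, hu]) : φ.comp j = ι.comp ψ) w
  obtain ⟨C, hC⟩ := fgNorm_map_le j
  obtain ⟨τ₀, hτ₀⟩ : ∃ τ₀ : G ⧸ ι.range, τ₀ = (1 : G) := ⟨_, rfl⟩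
  have hfix : ∀ w, φ (j w) • τ₀ = τ₀ := by
    intro w
    rw [hφj, hτ₀, MulAction.Quotient.smul_coe, QuotientGroup.eq]
    simp
  obtain ⟨v, hv⟩ : ∃ v, ι (ψ v) = s τ₀ := by
    obtain ⟨g, hg⟩ : s τ₀ ∈ ι.range := by
      have := hsmk τ₀
      nth_rw 2 [hτ₀] at this
      simpa using QuotientGroup.eq.1 this.symm
    obtain ⟨v, rfl⟩ := hψ g
    exact ⟨v, hg⟩
  let f₁ : FreeGroup Y →* FreeGroup Y := MonoidHom.mk' (fun w => ρ (j w) τ₀) fun a b => by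
    rw [_root_.map_mul, hρ, hfix]
  have hf₁ : ∀ w, f₁ w = ρ (j w) τ₀ := fun _ => rfl
  let f₂ : FreeGroup Y →* FreeGroup Y := (MulAut.conj v⁻¹).toMonoidHom
  have hf₂ : ∀ w, f₂ w = v⁻¹ * w * v := fun w => by simp [f₂]
  have hf₁₂ : ∀ w, ψ (f₁ w) = ψ (f₂ w) := by
    intro w
    apply hι
    have := hs (j w) τ₀
    rw [hfix, ← hv, hφj] at this
    rw [hf₁, hf₂]
    simp only [_root_.map_mul, _root_.map_inv, mul_assoc]
    rw [eq_inv_mul_iff_mul_eq, this]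
  let S : Set (FreeGroup Y) :=
    Set.image2 ρ R Set.univ ∪ Set.range fun y => f₁ (of y) * (f₂ (of y))⁻¹
  refine ⟨S, C, hψ, (h.finite.image2 _ Set.finite_univ).union (Set.finite_range _), ?_, ?_⟩
  · rintro _ (⟨r, hr, τ, -, rfl⟩ | ⟨y, rfl⟩)
    · have := hs r τ
      rw [h.map_eq_one r hr, one_smul, one_mul, mul_eq_left] at this
      exact hι (by rw [this, _root_.map_one])
    · simp [hf₁₂]
  · intro w l hw hl
    have h₁ : AreaLE S (f₁ w) (f (C * l)) := AreaLE.cocycle hρ h.map_eq_one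
      (fun r hr τ => Or.inl ⟨r, hr, τ, trivial, rfl⟩)
      (h.areaLE (j w) _ (by rw [hφj, hw, _root_.map_one]) ((hC w).trans (Nat.mul_le_mul_left _ hl)))
      τ₀
    have h₂ : Near S (1 * fgNorm w) (f₁ w) (f₂ w) :=
      Near.of_generators (fun y => AreaLE.of_mem (Or.inr ⟨y, rfl⟩)) w
    have h₃ := (h₂.symm.areaLE h₁).conj v
    simp only [hf₂, mul_assoc, mul_inv_cancel_left, mul_inv_cancel, mul_one, one_mul] at h₃
    exact h₃.mono (by omega)

open FreeGroup in
/-- Filling bounds pass to finite-index overgroups. -/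
theorem Fills.of_finiteIndex_range {X Y G G' : Type*} [Finite X] [Finite Y] [Group G] [Group G']
    {ι : G' →* G} (hι : Function.Injective ι) (hfin : ι.range.FiniteIndex)
    {ψ : FreeGroup Y →* G'} {S : Set (FreeGroup Y)} {f : ℕ → ℕ} (h : Fills ψ S f)
    {φ : FreeGroup X →* G} (hφ : Function.Surjective φ) :
    ∃ (R : Set (FreeGroup X)) (C : ℕ), Fills φ R fun l => f (C * l) + l := by
  have : Finite (G ⧸ ι.range) := Subgroup.finite_quotient_of_finiteIndex
  obtain ⟨ρ, s, C, hρ, hs, hC, -⟩ := exists_rewriting hfin φ h.surjective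
  choose u hu using fun y => hφ (ι (ψ (of y)))
  obtain ⟨j, hj⟩ := exists_hom u
  have hφj : ∀ w, φ (j w) = ι (ψ w) := fun w => DFunLike.congr_fun
    (FreeGroup.ext_hom _ _ (by simp [hj, hu]) : φ.comp j = ι.comp ψ) w
  choose σ hσ using fun τ => hφ (s τ)
  let R : Set (FreeGroup X) := (Set.range fun p : X × (G ⧸ ι.range) =>
    of p.1 * σ p.2 * (σ (φ (of p.1) • p.2) * j (ρ (of p.1) p.2))⁻¹) ∪ j '' S
  refine ⟨R, C, hφ, (Set.finite_range _).union (h.finite.image j), ?_, ?_⟩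
  · rintro _ (⟨p, rfl⟩ | ⟨r, hr, rfl⟩)
    · simp only [_root_.map_mul, _root_.map_inv, hσ, hφj, hs, mul_inv_cancel]
    · rw [hφj, h.map_eq_one r hr, _root_.map_one]
  · intro w l hw hl
    obtain ⟨τ⟩ : Nonempty (G ⧸ ι.range) := inferInstance
    have h₁ := near_cocycle (R := R) hρ (j := j) (σ := σ)
      (fun x τ => AreaLE.of_mem (Or.inl ⟨(x, τ), rfl⟩)) w τ
    have h₂ : ψ (ρ w τ) = 1 := by
      have := hs w τ
      rw [hw, one_smul, one_mul, mul_eq_left] at this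
      exact hι (by rw [this, _root_.map_one])
    have h₃ := (h.areaLE (ρ w τ) (C * l) h₂ ((hC w τ).trans (Nat.mul_le_mul_left _ hl))).map j
      (S := R) (K := 1) fun r hr => AreaLE.of_mem (Or.inr ⟨r, hr, rfl⟩)
    rw [hw, one_smul] at h₁
    have h₄ := (h₁.mul_right (σ τ)⁻¹).areaLE (h₃.conj (σ τ))
    rw [mul_inv_cancel_right] at h₄
    exact h₄.mono (by omega)

lemma Presents.fills {X G : Type*} [Finite X] [Group G] {R : Set (FreeGroup X)}
    {φ : FreeGroup X →* G} (h : Presents R φ) (hR : R.Finite) : Fills φ R (dehn R) where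
  surjective := h.1
  finite := hR
  map_eq_one r hr := by
    rw [← MonoidHom.mem_ker, h.2]
    exact Subgroup.subset_normalClosure hr
  areaLE w l hw hl := by
    rw [← MonoidHom.mem_ker, h.2] at hw
    exact (AreaLE.of_area hw).mono (area_le_dehn hw hl)

lemma Fills.dehn_le {X G : Type*} [Group G] {R S : Set (FreeGroup X)} {φ : FreeGroup X →* G}
    {f : ℕ → ℕ} (h : Fills φ S f) (hR : Presents R φ) : ∃ K, ∀ l, dehn R l ≤ K * f l := by
  have hS : ∀ r ∈ S, ∃ N, AreaLE R r N := fun r hr => AreaLE.of_mem_normalClosure <| by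
    rw [← hR.2, MonoidHom.mem_ker, h.map_eq_one r hr]
  choose! N hN using hS
  obtain ⟨K, hK⟩ := (h.finite.image N).bddAbove
  refine ⟨K, fun l => _root_.dehn_le fun w hw hl => ?_⟩
  rw [← hR.2, MonoidHom.mem_ker] at hw
  simpa using (h.areaLE w l hw hl).map (MonoidHom.id _) (S := R) (K := K)
    fun r hr => (hN r hr).mono (hK ⟨r, hr, rfl⟩)

/-! ### A quadratic lower bound -/

/-- The integral Heisenberg group. -/
@[ext]
structure Heisenberg where
  /-- the first abelian coordinate -/
  x : ℤ
  /-- the second abelian coordinate -/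
  y : ℤ
  /-- the central coordinate -/
  z : ℤ

namespace Heisenberg

instance : Mul Heisenberg := ⟨fun g h => ⟨g.x + h.x, g.y + h.y, g.z + h.z + g.x * h.y⟩⟩
instance : One Heisenberg := ⟨⟨0, 0, 0⟩⟩
instance : Inv Heisenberg := ⟨fun g => ⟨-g.x, -g.y, -g.z + g.x * g.y⟩⟩

@[simp] lemma mul_x (g h : Heisenberg) : (g * h).x = g.x + h.x := rfl
@[simp] lemma mul_y (g h : Heisenberg) : (g * h).y = g.y + h.y := rfl
@[simp] lemma mul_z (g h : Heisenberg) : (g * h).z = g.z + h.z + g.x * h.y := rfl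
@[simp] lemma one_x : (1 : Heisenberg).x = 0 := rfl
@[simp] lemma one_y : (1 : Heisenberg).y = 0 := rfl
@[simp] lemma one_z : (1 : Heisenberg).z = 0 := rfl
@[simp] lemma inv_x (g : Heisenberg) : g⁻¹.x = -g.x := rfl
@[simp] lemma inv_y (g : Heisenberg) : g⁻¹.y = -g.y := rfl
@[simp] lemma inv_z (g : Heisenberg) : g⁻¹.z = -g.z + g.x * g.y := rfl

instance : Group Heisenberg := Group.ofLeftAxioms
  (fun g h k => by ext <;> simp <;> ring)
  (fun g => by ext <;> simp)
  (fun g => by ext <;> simp)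

/-- The first coordinate as a homomorphism. -/
def xHom : Heisenberg →* Multiplicative ℤ where
  toFun g := .ofAdd g.x
  map_one' := rfl
  map_mul' _ _ := rfl

/-- The second coordinate as a homomorphism. -/
def yHom : Heisenberg →* Multiplicative ℤ where
  toFun g := .ofAdd g.y
  map_one' := rfl
  map_mul' _ _ := rfl

lemma pow_x (g : Heisenberg) (m : ℕ) : (g ^ m).x = m * g.x := by
  induction m with
  | zero => simp
  | succ m ih => simp [pow_succ, ih]; ring

lemma pow_y (g : Heisenberg) (m : ℕ) : (g ^ m).y = m * g.y := by
  induction m with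
  | zero => simp
  | succ m ih => simp [pow_succ, ih]; ring

end Heisenberg

open FreeGroup in
/-- A group with two commuting elements that are independent in its abelianization modulo torsion
has at least quadratic filling bounds. -/
theorem Fills.sq_le {X A : Type*} [Group A] {φ : FreeGroup X →* A} {R : Set (FreeGroup X)}
    {f : ℕ → ℕ} (h : Fills φ R f) {χ₁ χ₂ : A →* Multiplicative ℤ} {a b : A} (hab : Commute a b)
    (ha₁ : χ₁ a = .ofAdd 1) (ha₂ : χ₂ a = 1) (hb₁ : χ₁ b = 1) (hb₂ : χ₂ b = .ofAdd 1) :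
    ∃ K C : ℕ, ∀ m, m ^ 2 ≤ K * f (C * m) := by
  obtain ⟨Φ, hΦ⟩ := exists_hom fun x : X =>
    (⟨(χ₁ (φ (of x))).toAdd, (χ₂ (φ (of x))).toAdd, 0⟩ : Heisenberg)
  have hx : ∀ w, Multiplicative.ofAdd (Φ w).x = χ₁ (φ w) := fun w => DFunLike.congr_fun
    (FreeGroup.ext_hom _ _ (by simp [Heisenberg.xHom, hΦ]) :
      Heisenberg.xHom.comp Φ = χ₁.comp φ) w
  have hy : ∀ w, Multiplicative.ofAdd (Φ w).y = χ₂ (φ w) := fun w => DFunLike.congr_fun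
    (FreeGroup.ext_hom _ _ (by simp [Heisenberg.yHom, hΦ]) :
      Heisenberg.yHom.comp Φ = χ₂.comp φ) w
  have hx' : ∀ w, φ w = 1 → (Φ w).x = 0 := fun w hw => by simpa [hw] using hx w
  have hy' : ∀ w, φ w = 1 → (Φ w).y = 0 := fun w hw => by simpa [hw] using hy w
  obtain ⟨K, hK⟩ := (h.finite.image fun r => (Φ r).z.natAbs).bddAbove
  have key : ∀ w N, AreaLE R w N → φ w = 1 ∧ (Φ w).z.natAbs ≤ K * N := by
    intro w N hw
    refine AreaLE.induction (P := fun w n => φ w = 1 ∧ (Φ w).z.natAbs ≤ K * n) ?_ ?_ ?_ ?_ hw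
    · simp
    · rintro g r w n hr ⟨ih₁, ih₂⟩
      have hr₁ := h.map_eq_one r hr
      have hr₂ : (Φ r).z.natAbs ≤ K := hK ⟨r, hr, rfl⟩
      refine ⟨by simp [hr₁, ih₁], ?_⟩
      have : (Φ (g * r * g⁻¹ * w)).z = (Φ r).z + (Φ w).z := by
        simp [hx' _ hr₁, hy' _ hr₁, hy' _ ih₁]
        ring
      rw [this, mul_add_one, add_comm]
      exact (Int.natAbs_add_le _ _).trans (by omega)
    · rintro g r w n hr ⟨ih₁, ih₂⟩
      have hr₁ := h.map_eq_one r hr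
      have hr₂ : (Φ r).z.natAbs ≤ K := hK ⟨r, hr, rfl⟩
      refine ⟨by simp [hr₁, ih₁], ?_⟩
      have : (Φ (g * r⁻¹ * g⁻¹ * w)).z = -(Φ r).z + (Φ w).z := by
        simp [hx' _ hr₁, hy' _ hr₁, hy' _ ih₁]
        ring
      rw [this, mul_add_one, add_comm]
      exact (Int.natAbs_add_le _ _).trans (by rw [Int.natAbs_neg]; omega)
    · rintro w m n hmn ⟨h₁, h₂⟩
      exact ⟨h₁, h₂.trans (Nat.mul_le_mul_left _ hmn)⟩
  obtain ⟨u, rfl⟩ := h.surjective a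
  obtain ⟨v, rfl⟩ := h.surjective b
  have hux : (Φ u).x = 1 := Multiplicative.ofAdd.injective (by rw [hx, ha₁])
  have huy : (Φ u).y = 0 := Multiplicative.ofAdd.injective (by rw [hy, ha₂]; rfl)
  have hvx : (Φ v).x = 0 := Multiplicative.ofAdd.injective (by rw [hx, hb₁]; rfl)
  have hvy : (Φ v).y = 1 := Multiplicative.ofAdd.injective (by rw [hy, hb₂])
  refine ⟨K, 2 * (fgNorm u + fgNorm v), fun m => ?_⟩
  have hw : φ (u ^ m * v ^ m * (u ^ m)⁻¹ * (v ^ m)⁻¹) = 1 := by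
    have := (hab.pow_pow m m).eq
    simp [this]
  have hl : fgNorm (u ^ m * v ^ m * (u ^ m)⁻¹ * (v ^ m)⁻¹) ≤ 2 * (fgNorm u + fgNorm v) * m := by
    have h₁ := fgNorm_mul_le (u ^ m * v ^ m * (u ^ m)⁻¹) (v ^ m)⁻¹
    have h₂ := fgNorm_mul_le (u ^ m * v ^ m) (u ^ m)⁻¹
    have h₃ := fgNorm_mul_le (u ^ m) (v ^ m)
    have h₄ := fgNorm_pow_le u m
    have h₅ := fgNorm_pow_le v m
    rw [fgNorm_inv] at h₁ h₂
    have : 2 * (fgNorm u + fgNorm v) * m = 2 * (m * fgNorm u) + 2 * (m * fgNorm v) := by ring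
    omega
  have hz : (Φ (u ^ m * v ^ m * (u ^ m)⁻¹ * (v ^ m)⁻¹)).z = (m : ℤ) ^ 2 := by
    simp only [_root_.map_mul, _root_.map_inv, _root_.map_pow, Heisenberg.mul_z, Heisenberg.inv_z,
      Heisenberg.mul_x, Heisenberg.inv_x, Heisenberg.inv_y, Heisenberg.pow_x,
      Heisenberg.pow_y, hux, huy, hvx, hvy]
    ring
  have := (key _ _ (h.areaLE _ _ hw hl)).2
  rw [hz] at this
  simpa [Int.natAbs_pow] using this

/-! ### Reduction to fibre products over a free abelian group -/

lemma exists_pow_eq_one_of_isOfFinOrder (Q : Type*) [CommGroup Q] [Group.FG Q] :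
    ∃ e : ℕ, e ≠ 0 ∧ ∀ x : Q, ∀ k : ℕ, k ≠ 0 → x ^ k = 1 → x ^ e = 1 := by
  have : Finite (Submodule.torsion ℤ (Additive Q)) :=
    Module.finite_of_fg_torsion _ Submodule.torsion_isTorsion
  refine ⟨Nat.card (Submodule.torsion ℤ (Additive Q)), Nat.card_pos.ne', fun x k hk hx => ?_⟩
  have hmem : Additive.ofMul x ∈ Submodule.torsion ℤ (Additive Q) := by
    refine (Submodule.mem_torsion_iff _).2 ⟨⟨k, mem_nonZeroDivisors_of_ne_zero (by simpa)⟩, ?_⟩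
    rw [Submonoid.mk_smul, natCast_zsmul, ← ofMul_pow, hx, ofMul_one]
  have := congrArg Subtype.val
    (card_nsmul_eq_zero' (x := (⟨_, hmem⟩ : Submodule.torsion ℤ (Additive Q))))
  simpa [← ofMul_pow] using this

/-- A finitely generated abelian group of rank `r` has a finite-index subgroup isomorphic to `ℤ^r`
contained in each of finitely many subgroups with torsion quotients. -/
lemma exists_finiteIndex_hom_bijective {Q : Type} [CommGroup Q] [Group.FG Q] {r : ℕ}
    (hrank : Module.rank ℚ (ℚ ⊗[ℤ] Additive Q) = r) {n : ℕ} (P : Fin n → Subgroup Q)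
    (hP : ∀ i x, ∃ k : ℕ, k ≠ 0 ∧ x ^ k ∈ P i) :
    ∃ (W : Subgroup Q) (e : W →* Multiplicative (Fin r → ℤ)), W.FiniteIndex ∧
      (∀ i, W ≤ P i) ∧ Function.Bijective e := by
  obtain ⟨S, hS, hSfin⟩ := Group.fg_iff.1 (inferInstance : Group.FG Q)
  choose k hk hkP using hP
  obtain ⟨E, hE, hEt⟩ := exists_pow_eq_one_of_isOfFinOrder Q
  obtain ⟨K, hK, hKP⟩ : ∃ K : ℕ, K ≠ 0 ∧ ∀ x i, x ^ K ∈ P i := by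
    refine ⟨∏ i, ∏ s ∈ hSfin.toFinset, k i s,
      Finset.prod_ne_zero_iff.2 fun i _ => Finset.prod_ne_zero_iff.2 fun s _ => hk i s,
      fun x i => ?_⟩
    have hx : x ∈ Subgroup.closure S := hS ▸ mem_top x
    induction hx using Subgroup.closure_induction with
    | mem x hx =>
      obtain ⟨m, hm⟩ : k i x ∣ ∏ i, ∏ s ∈ hSfin.toFinset, k i s :=
        (Finset.dvd_prod_of_mem (k i) (hSfin.mem_toFinset.2 hx)).trans
          (Finset.dvd_prod_of_mem (fun i => ∏ s ∈ hSfin.toFinset, k i s) (Finset.mem_univ i))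
      rw [hm, pow_mul]
      exact pow_mem (hkP i x) m
    | one => simp
    | mul x y _ _ hx hy => rw [mul_pow]; exact mul_mem hx hy
    | inv x _ hx => rw [inv_pow]; exact inv_mem hx
  obtain ⟨L, hL⟩ : ∃ L, L = K * E := ⟨_, rfl⟩
  have hL0 : L ≠ 0 := hL ▸ mul_ne_zero hK hE
  let f : Additive Q →ₗ[ℤ] Additive Q := LinearMap.lsmul ℤ _ (L : ℤ)
  have hf : ∀ x, f x = L • x := fun x => by simp [f]
  have hker : LinearMap.ker f ≤ Submodule.torsion ℤ (Additive Q) := by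
    intro x hx
    refine (Submodule.mem_torsion_iff _).2
      ⟨⟨(L : ℤ), mem_nonZeroDivisors_of_ne_zero (by simpa)⟩, ?_⟩
    simpa [hf] using hx
  have hfin : Module.finrank ℤ (LinearMap.range f) = r := by
    rw [← f.quotKerEquivRange.finrank_eq, finrank_quotient_eq_of_le_torsion hker,
      ← IsLocalizedModule.finrank_eq (nonZeroDivisors ℤ) (TensorProduct.mk ℤ ℚ (Additive Q) 1)
        le_rfl, ← IsLocalization.finrank_eq ℚ (nonZeroDivisors ℤ) le_rfl]
    exact Module.finrank_eq_of_rank_eq hrank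
  have hfree : Module.IsTorsionFree ℤ (LinearMap.range f) := by
    refine Module.IsTorsionFree.of_smul_eq_zero ?_
    rintro m ⟨_, x, rfl⟩ hm
    rw [or_iff_not_imp_left]
    intro hm0
    have h₁ : m.natAbs • L • x = 0 := by
      have := congrArg Subtype.val hm
      simp only [hf, Submodule.coe_smul, Submodule.coe_zero] at this
      rcases Int.natAbs_eq m with h | h <;> rw [h] at this <;> simpa using this
    have h₂ : x.toMul ^ (L * m.natAbs) = 1 := by
      rw [pow_mul]
      exact congrArg Additive.toMul h₁
    have h₃ := hEt _ _ (mul_ne_zero hL0 (Int.natAbs_ne_zero.2 hm0)) h₂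
    refine Subtype.ext ((hf x).trans ?_)
    rw [hL]
    change Additive.ofMul (x.toMul ^ (K * E)) = 0
    rw [mul_comm, pow_mul, h₃, one_pow, ofMul_one]
  let e := (Module.finBasisOfFinrankEq ℤ (LinearMap.range f) hfin).equivFun
  let W : Subgroup Q := (powMonoidHom L).range
  have hW : ∀ x : W, Additive.ofMul (x : Q) ∈ LinearMap.range f := by
    rintro ⟨_, x, rfl⟩
    exact ⟨Additive.ofMul x, by simp [hf]⟩
  refine ⟨W, ⟨⟨fun x => .ofAdd (e ⟨_, hW x⟩), ?_⟩, ?_⟩,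
    finiteIndex_range_powMonoidHom_of_fg _ hL0, ?_, ?_, ?_⟩
  · rw [← ofAdd_zero, ← map_zero e]
    rfl
  · intro x y
    rw [← ofAdd_add, ← map_add]
    rfl
  · rintro i _ ⟨x, rfl⟩
    rw [powMonoidHom_apply, hL, pow_mul]
    exact pow_mem (hKP x i) _
  · intro x y hxy
    have := e.injective (Multiplicative.ofAdd.injective hxy)
    exact Subtype.ext (Additive.ofMul.injective (Subtype.mk.inj this))
  · intro t
    obtain ⟨⟨_, x, rfl⟩, hx⟩ := e.surjective t.toAdd
    refine ⟨⟨_, x.toMul, rfl⟩, ?_⟩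
    rw [← ofAdd_toAdd t, ← hx]
    exact congrArg (fun y => Multiplicative.ofAdd (e y)) (Subtype.ext (by simp [hf]))

lemma range_mulSingle_normal {I : Type*} [DecidableEq I] (Γ : I → Type*) [∀ i, Group (Γ i)]
    (i : I) : (MonoidHom.mulSingle Γ i).range.Normal := by
  refine ⟨?_⟩
  rintro _ ⟨a, rfl⟩ g
  refine ⟨g i * a * (g i)⁻¹, funext fun j => ?_⟩
  obtain rfl | h := eq_or_ne j i
  · simp
  · simp [Pi.mulSingle_eq_of_ne h]

lemma finiteIndex_comap {G G' : Type*} [Group G] [Group G'] (f : G →* G') {K : Subgroup G'}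
    (hK : K.FiniteIndex) : (K.comap f).FiniteIndex :=
  ⟨by
    rw [Subgroup.index_comap]
    exact (inferInstance : (K.subgroupOf f.range).FiniteIndex).index_ne_zero⟩

open Subgroup in
/-- A virtually full, virtually coabelian subgroup restricts to the kernel of a product of
epimorphisms onto a free abelian group on finite-index subgroups of the factors. -/
theorem exists_finiteIndex_factors {n : ℕ} {Γ : Fin n → Type} [∀ i, Group (Γ i)]
    [∀ i, Group.FG (Γ i)] {H D' : Subgroup (∀ i, Γ i)}
    (hfull : ∀ i, ((MonoidHom.mulSingle Γ i).range ⊔ H).FiniteIndex) (hD' : D'.FiniteIndex)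
    {r : ℕ} {Q : Type} [CommGroup Q] {q : D' →* Q}
    (hqsurj : Function.Surjective q) (hqker : q.ker = H.subgroupOf D')
    (hrank : Module.rank ℚ (ℚ ⊗[ℤ] Additive Q) = r) :
    ∃ (E : ∀ i, Subgroup (Γ i)) (θ : ∀ i, E i →* Multiplicative (Fin r → ℤ)),
      (∀ i, (E i).FiniteIndex) ∧ (∀ i, Function.Surjective (θ i)) ∧
      ∀ d : ∀ i, E i, (∏ i, θ i (d i) = 1 ↔ (fun i => (d i : Γ i)) ∈ H) := by
  have hqH : ∀ d : D', q d = 1 ↔ (d : ∀ i, Γ i) ∈ H := fun d => by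
    rw [← MonoidHom.mem_ker, hqker, mem_subgroupOf]
  have : Group.FG Q := Group.fg_of_surjective hqsurj
  let M := D'.normalCore.index
  have hM : M ≠ 0 := (Subgroup.finiteIndex_normalCore D').index_ne_zero
  have hMD : ∀ x, x ^ M ∈ D' := fun x => D'.normalCore_le (pow_index_mem _ x)
  let P : Fin n → Subgroup Q := fun i => ((MonoidHom.mulSingle Γ i).range.subgroupOf D').map q
  have hP : ∀ i x, ∃ k : ℕ, k ≠ 0 ∧ x ^ k ∈ P i := by
    intro i x
    obtain ⟨d, rfl⟩ := hqsurj x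
    obtain ⟨k, hk, -, hdk⟩ := exists_pow_mem_of_index_ne_zero (hfull i).index_ne_zero
      (d : ∀ i, Γ i)
    have := range_mulSingle_normal Γ i
    obtain ⟨_, ⟨γ, rfl⟩, h, hh, hγh⟩ := mem_sup_of_normal_left.1 hdk
    refine ⟨k * M, mul_ne_zero hk.ne' hM, d ^ (k * M) * ⟨h ^ M, hMD h⟩⁻¹, ?_, ?_⟩
    · refine ⟨(((d : ∀ i, Γ i) ^ k) ^ M * (h ^ M)⁻¹) i, funext fun j => ?_⟩
      obtain rfl | hj := eq_or_ne j i
      · simp [pow_mul]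
      · simp [pow_mul, ← hγh, Pi.mulSingle_eq_of_ne hj]
    · have : q ⟨h ^ M, hMD h⟩ = 1 := (hqH _).2 (pow_mem hh M)
      simp [this]
  obtain ⟨W, e, hW, hWP, he⟩ := exists_finiteIndex_hom_bijective hrank P hP
  have hD'' : ((W.comap q).map D'.subtype).FiniteIndex := ⟨by
    rw [index_map_subtype, index_comap_of_surjective _ hqsurj]
    exact mul_ne_zero hW.index_ne_zero hD'.index_ne_zero⟩
  let E : ∀ i, Subgroup (Γ i) := fun i =>
    ((W.comap q).map D'.subtype).comap (MonoidHom.mulSingle Γ i)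
  have hE : ∀ i (γ : E i), MonoidHom.mulSingle Γ i γ ∈ D' := by
    rintro i ⟨γ, d, -, hd⟩
    exact hd ▸ d.2
  let j : ∀ i, E i →* D' := fun i =>
    ((MonoidHom.mulSingle Γ i).comp (E i).subtype).codRestrict D' (hE i)
  have hj : ∀ i (γ : E i) k, (j i γ : ∀ i, Γ i) k = Pi.mulSingle i (γ : Γ i) k :=
    fun _ _ _ => rfl
  have hjW : ∀ i (γ : E i), q (j i γ) ∈ W := by
    rintro i ⟨γ, d, hd, hd'⟩
    have : j i ⟨γ, d, hd, hd'⟩ = d := Subtype.ext hd'.symm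
    rw [this]
    exact hd
  let ϑ : ∀ i, E i →* W := fun i => (q.comp (j i)).codRestrict W (hjW i)
  have hmem : ∀ d : ∀ i, E i, (fun i => (d i : Γ i)) ∈ D' := fun d =>
    pi_mem_of_mulSingle_mem _ fun i => hE i (d i)
  let Ψ : (∀ i, E i) →* D' :=
    { toFun := fun d => ⟨fun i => (d i : Γ i), hmem d⟩
      map_one' := rfl
      map_mul' := fun _ _ => rfl }
  have hΨ : q.comp Ψ = ∏ i, (q.comp (j i)).comp (Pi.evalMonoidHom _ i) := by
    refine MonoidHom.pi_ext fun i γ => ?_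
    rw [MonoidHom.finsetProd_apply, Finset.prod_eq_single i]
    · have : Ψ (Pi.mulSingle i γ) = j i γ := Subtype.ext <| funext fun k => by
        obtain rfl | hk := eq_or_ne k i
        · simp [Ψ, hj]
        · simp [Ψ, hj, Pi.mulSingle_eq_of_ne hk]
      simp [this]
    · intro k _ hk
      simp [Pi.mulSingle_eq_of_ne hk]
    · simp
  refine ⟨E, fun i => e.comp (ϑ i), fun i => finiteIndex_comap _ hD'', ?_, ?_⟩
  · intro i t
    obtain ⟨w, rfl⟩ := he.2 t
    obtain ⟨d, ⟨γ, hγ⟩, hd⟩ := hWP i w.2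
    refine ⟨⟨γ, d, ?_, hγ.symm⟩, ?_⟩
    · change q d ∈ W
      rw [hd]
      exact w.2
    · refine congrArg e (Subtype.ext (Eq.trans ?_ hd))
      exact congrArg q (Subtype.ext hγ)
  · intro d
    have h₁ : ∏ i, (e.comp (ϑ i)) (d i) = e (∏ i, ϑ i (d i)) := by simp
    rw [h₁, map_eq_one_iff e he.1, ← hqH ⟨_, hmem d⟩]
    change _ ↔ q.comp Ψ d = 1
    rw [hΨ, MonoidHom.finsetProd_apply, ← OneMemClass.coe_eq_one, Subgroup.val_finsetProd]
    rfl

/-! ### Fibre products of direct products -/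

lemma Fills.mono {X G : Type} [Group G] {φ : FreeGroup X →* G} {R : Set (FreeGroup X)}
    {f g : ℕ → ℕ} (h : Fills φ R f) (hfg : ∀ l, f l ≤ g l) : Fills φ R g :=
  ⟨h.surjective, h.finite, h.map_eq_one, fun w l hw hl => (h.areaLE w l hw hl).mono (hfg l)⟩

lemma Pi.commute_mulSingle {I : Type*} [DecidableEq I] {A : I → Type*} [∀ i, Group (A i)]
    {f : ∀ i, A i} {j : I} (h : f j = 1) (a : A j) : Commute f (Pi.mulSingle j a) := by
  refine funext fun i => ?_
  obtain rfl | hi := eq_or_ne i j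
  · simp [h]
  · simp [Pi.mulSingle_eq_of_ne hi]

/-- Finitely generated groups have finite families `g` such that the `Pi.mulSingle i (g i s)`
generate the direct product. -/
lemma exists_finite_mulSingle_generators {I : Type} [Finite I] [DecidableEq I] (A : I → Type)
    [∀ i, Group (A i)] [∀ i, Group.FG (A i)] :
    ∃ (X : Type) (_ : Finite X) (j : X → I) (s : ∀ x, A (j x)),
      Subgroup.closure (Set.range fun x => (Pi.mulSingle (j x) (s x) : ∀ i, A i)) = ⊤ := by
  choose S hS hSfin using fun i => Group.fg_iff.1 (inferInstance : Group.FG (A i))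
  have : ∀ i, Finite (S i) := fun i => (hSfin i).to_subtype
  refine ⟨Σ i, S i, inferInstance, Sigma.fst, fun x => x.2, ?_⟩
  refine eq_top_iff.2 fun d _ => Subgroup.pi_mem_of_mulSingle_mem _ fun i => ?_
  have : (⊤ : Subgroup (A i)) ≤ (Subgroup.closure (Set.range fun x : Σ i, S i =>
      (Pi.mulSingle x.1 (x.2 : A x.1) : ∀ i, A i))).comap (MonoidHom.mulSingle A i) := by
    rw [← hS i, Subgroup.closure_le]
    exact fun s hs => Subgroup.subset_closure ⟨⟨i, s, hs⟩, rfl⟩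
  exact this (Subgroup.mem_top (d i))

lemma FreeGroup.lift_sumElim_surjective {I X G : Type*} [Group G] {f : I → G} {g : X → G}
    (hg : Subgroup.closure (Set.range g) = ⊤) :
    Function.Surjective (FreeGroup.lift (Sum.elim f g)) := by
  rw [← MonoidHom.range_eq_top, FreeGroup.range_lift_eq_closure, eq_top_iff, ← hg]
  exact Subgroup.closure_mono fun _ ⟨x, hx⟩ => ⟨.inr x, hx⟩

lemma FreeGroup.lift_single_surjective (κ : Type*) [Fintype κ] [DecidableEq κ] :
    Function.Surjective (FreeGroup.lift fun k : κ =>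
      Multiplicative.ofAdd (Pi.single k (1 : ℤ) : κ → ℤ)) := by
  intro t
  rw [← MonoidHom.mem_range]
  have ht : t = ∏ k, Multiplicative.ofAdd (Pi.single k (1 : ℤ) : κ → ℤ) ^ t.toAdd k := by
    refine Multiplicative.toAdd.injective (funext fun k => ?_)
    simp [toAdd_prod, Finset.sum_apply, Pi.single_apply]
  rw [ht]
  exact Subgroup.prod_mem _ fun k _ => Subgroup.zpow_mem _
    (MonoidHom.mem_range.2 ⟨.of k, FreeGroup.lift_apply_of⟩) _

/-- Epimorphisms from the factors of a direct product onto `ℤ^κ` admit a common section, with the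
basis vector `k` sent to the factor `c k`. -/
lemma exists_prod_section {I κ : Type} [Fintype I] [Fintype κ] [DecidableEq κ] {c : κ → I}
    (hc : Function.Injective c) {A : I → Type} [∀ i, Group (A i)]
    {θ : ∀ i, A i →* Multiplicative (κ → ℤ)} (hθ : ∀ i, Function.Surjective (θ i)) :
    ∃ s : Multiplicative (κ → ℤ) →* ∀ i, A i, (∀ v, ∏ i, θ i (s v i) = v) ∧
      ∀ k i, i ≠ c k → s (.ofAdd (Pi.single k 1)) i = 1 := by
  classical
  choose σ hσ using fun i k => hθ i (.ofAdd (Pi.single k 1))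
  let ev : κ → Multiplicative (κ → ℤ) →* Multiplicative ℤ := fun k =>
    (Pi.evalAddMonoidHom (fun _ : κ => ℤ) k).toMultiplicative
  let s : Multiplicative (κ → ℤ) →* ∀ i, A i := MonoidHom.pi fun i =>
    if h : ∃ k, c k = i then (zpowersHom (A i) (σ i h.choose)).comp (ev h.choose) else 1
  have hs : ∀ v k, s v (c k) = σ (c k) k ^ (v.toAdd k) := by
    intro v k
    have h : ∃ k', c k' = c k := ⟨k, rfl⟩
    have hk : h.choose = k := hc h.choose_spec
    simp only [s, MonoidHom.pi_apply, dif_pos h, hk]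
    rfl
  have hs' : ∀ v i, (∀ k, c k ≠ i) → s v i = 1 := by
    intro v i hi
    have h : ¬ ∃ k, c k = i := by simpa using hi
    simp only [s, MonoidHom.pi_apply, dif_neg h]
    rfl
  refine ⟨s, fun v => ?_, fun k i hi => ?_⟩
  · rw [← Fintype.prod_of_injective c hc (fun k => θ (c k) (s v (c k)))]
    · refine Multiplicative.toAdd.injective (funext fun k => ?_)
      simp [hs, hσ, toAdd_prod, Finset.sum_apply, Pi.single_apply]
    · intro i hi
      rw [hs' v i (by simpa using hi), map_one]
    · exact fun _ => rfl
  · by_cases h : ∃ k', c k' = i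
    · obtain ⟨k', rfl⟩ := h
      have : k' ≠ k := fun h => hi (h ▸ rfl)
      simp [hs, this]
    · exact hs' _ _ (by simpa using h)

theorem exists_fills_prod_mul_prod_eq_one {I κ : Type} [Fintype I] [Fintype κ] [DecidableEq I]
    [DecidableEq κ] [Nontrivial I] [Nonempty κ] {c : κ → I} (hc : Function.Injective c)
    {A : I → Type} {B : κ → Type} [∀ i, Group (A i)] [∀ k, Group (B k)] [∀ i, Group.FG (A i)]
    [∀ k, Group.FG (B k)] {θ : ∀ i, A i →* Multiplicative (κ → ℤ)}
    {η : ∀ k, B k →* Multiplicative (κ → ℤ)} (hθ : ∀ i, Function.Surjective (θ i))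
    (hη : ∀ k, Function.Surjective (η k)) {G : Type} [Group G] {pA : G →* ∀ i, A i}
    {pB : G →* ∀ k, B k} (hinj : ∀ g, pA g = 1 → pB g = 1 → g = 1)
    (hrange : ∀ g, (∏ i, θ i (pA g i)) * ∏ k, η k (pB g k) = 1)
    (hsurj : ∀ a b, (∏ i, θ i (a i)) * ∏ k, η k (b k) = 1 → ∃ g, pA g = a ∧ pB g = b)
    {X Y : Type} [Finite X] [Finite Y] {φ : FreeGroup X →* ∀ i, A i}
    {ψ : FreeGroup Y →* ∀ k, B k} {R : Set (FreeGroup X)} {S : Set (FreeGroup Y)} {f g : ℕ → ℕ}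
    (hf : Monotone f) (hg : Monotone g) (hφ : Fills φ R f) (hψ : Fills ψ S g) :
    ∃ (Z : Type) (_ : Finite Z) (π : FreeGroup Z →* G) (U : Set (FreeGroup Z)) (C : ℕ),
      Fills π U fun l => 2 * f (C * l) + g (C * l) + C * (l + 1) ^ 5 := by
  obtain ⟨sA, hsA, hsA'⟩ := exists_prod_section hc hθ
  obtain ⟨sB, hsB, hsB'⟩ := exists_prod_section (Function.injective_id (α := κ)) hη
  obtain ⟨V, _, j, u, hu⟩ := exists_finite_mulSingle_generators A
  obtain ⟨W, _, j', u', hu'⟩ := exists_finite_mulSingle_generators B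
  let ε : κ → Multiplicative (κ → ℤ) := fun k => .ofAdd (Pi.single k 1)
  let θA : (∀ i, A i) →* Multiplicative (κ → ℤ) :=
    ∏ i, (θ i).comp (Pi.evalMonoidHom A i)
  let θB : (∀ k, B k) →* Multiplicative (κ → ℤ) :=
    (∏ k, (η k).comp (Pi.evalMonoidHom B k))⁻¹
  have hθA : ∀ a, θA a = ∏ i, θ i (a i) := fun a => by simp [θA, MonoidHom.finsetProd_apply]
  have hθB : ∀ b, θB b = (∏ k, η k (b k))⁻¹ := fun b => by simp [θB, MonoidHom.finsetProd_apply]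
  have htop : ∀ (P : Type) [Group P], (MonoidHom.id P).range.FiniteIndex := fun P _ => by
    rw [MonoidHom.range_eq_top.2 Function.surjective_id]
    infer_instance
  obtain ⟨R', C₁, hR'⟩ := Fills.of_finiteIndex (ι := MonoidHom.id _) Function.injective_id
    (htop _) hφ (FreeGroup.lift_sumElim_surjective (f := fun k => sA (ε k)) hu)
  obtain ⟨S', C₂, hS'⟩ := Fills.of_finiteIndex (ι := MonoidHom.id _) Function.injective_id
    (htop _) hψ (FreeGroup.lift_sumElim_surjective
      (f := fun k => (sB.comp invMonoidHom) (ε k)) hu')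
  have hgX : ∀ x : V, ∃ i, (∀ k, k ≠ i → Commute (sA (ε k)) (Pi.mulSingle (j x) (u x))) ∧
      ∃ a, θA a = ε i ∧ Commute a (Pi.mulSingle (j x) (u x)) ∧ Commute a (sA (ε i)) := by
    intro x
    by_cases hx : ∃ i, c i = j x
    · obtain ⟨i, hi⟩ := hx
      obtain ⟨i', hi'⟩ := exists_ne (j x)
      obtain ⟨a, ha⟩ := hθ i' (ε i)
      refine ⟨i, fun k hk => Pi.commute_mulSingle (hsA' k _ ?_) _, Pi.mulSingle i' a, ?_,
        Pi.commute_mulSingle (Pi.mulSingle_eq_of_ne hi'.symm _) _,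
        (Pi.commute_mulSingle (hsA' i _ (hi ▸ hi')) _).symm⟩
      · rw [← hi]
        exact fun h => hk (hc h).symm
      · rw [hθA, Finset.prod_eq_single i']
        · simp [ha]
        · intro k _ hk
          simp [Pi.mulSingle_eq_of_ne hk]
        · simp
    · have h : ∀ k, Commute (sA (ε k)) (Pi.mulSingle (j x) (u x)) := fun k =>
        Pi.commute_mulSingle (hsA' k _ fun h => hx ⟨k, h.symm⟩) _
      obtain ⟨i⟩ := ‹Nonempty κ›
      exact ⟨i, fun k _ => h k, sA (ε i), by rw [hθA, hsA], h i, Commute.refl _⟩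
  obtain ⟨π, U, C, hU⟩ := exists_fills_fibreProduct (ε := ε)
    (FreeGroup.lift_single_surjective κ) (sA := sA) (sB := sB.comp invMonoidHom) (θA := θA)
    (θB := θB) (fun v => by rw [hθA, hsA])
    (fun v => by rw [hθB, MonoidHom.comp_apply, hsB, invMonoidHom_apply, inv_inv]) hgX hinj
    (fun g => by rw [hθA, hθB, eq_inv_iff_mul_eq_one, hrange])
    (fun a b h => hsurj a b (by rwa [hθA, hθB, eq_inv_iff_mul_eq_one] at h)) hR' hS'
  refine ⟨_, inferInstance, π, U, C * (C₁ + C₂ + 4), hU.mono fun l => ?_⟩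
  have h₁ : f (C₁ * (C * l)) ≤ f (C * (C₁ + C₂ + 4) * l) := hf (by
    nlinarith [Nat.zero_le (C * l), Nat.zero_le (C₂ * (C * l))])
  have h₂ : g (C₂ * (C * l)) ≤ g (C * (C₁ + C₂ + 4) * l) := hg (by
    nlinarith [Nat.zero_le (C * l), Nat.zero_le (C₁ * (C * l))])
  have h₃ : C * l ≤ C * (l + 1) ^ 5 :=
    Nat.mul_le_mul_left C ((Nat.le_succ l).trans (Nat.le_self_pow (by norm_num) _))
  nlinarith [Nat.zero_le (C₁ * (C * (l + 1) ^ 5)), Nat.zero_le (C₂ * (C * (l + 1) ^ 5))]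

/-- The Dehn function of a direct product of two groups mapping onto `ℤ` is at least quadratic. -/
lemma Fills.sq_le_of_pi {I κ : Type} [DecidableEq I] [DecidableEq κ] [Nontrivial I] [Nonempty κ]
    {A : I → Type} [∀ i, Group (A i)] {θ : ∀ i, A i →* Multiplicative (κ → ℤ)}
    (hθ : ∀ i, Function.Surjective (θ i)) {X : Type} [Finite X] {φ : FreeGroup X →* ∀ i, A i}
    {R : Set (FreeGroup X)} {f : ℕ → ℕ} (h : Fills φ R f) :
    ∃ K C : ℕ, ∀ m, m ^ 2 ≤ K * f (C * m) := by
  obtain ⟨i, i', hi⟩ := exists_pair_ne I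
  obtain ⟨k⟩ := ‹Nonempty κ›
  obtain ⟨a, ha⟩ := hθ i (.ofAdd (Pi.single k 1))
  obtain ⟨b, hb⟩ := hθ i' (.ofAdd (Pi.single k 1))
  let χ : ∀ i, (∀ i, A i) →* Multiplicative ℤ := fun i =>
    ((Pi.evalAddMonoidHom (fun _ : κ => ℤ) k).toMultiplicative.comp (θ i)).comp
      (Pi.evalMonoidHom A i)
  have hχ : ∀ i d, χ i d = .ofAdd ((θ i (d i)).toAdd k) := fun _ _ => rfl
  refine h.sq_le (χ₁ := χ i) (χ₂ := χ i') (a := Pi.mulSingle i a) (b := Pi.mulSingle i' b)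
    (Pi.commute_mulSingle (Pi.mulSingle_eq_of_ne hi.symm _) _) ?_ ?_ ?_ ?_
  · simp [hχ, ha]
  · simp [hχ, Pi.mulSingle_eq_of_ne hi.symm]
  · simp [hχ, Pi.mulSingle_eq_of_ne hi]
  · simp [hχ, hb]

/-! ### The theorem -/

lemma FinitelyPresentedGroup.fg {G : Type*} [Group G] (h : FinitelyPresentedGroup G) :
    Group.FG G := by
  obtain ⟨X, _, R, φ, -, hφ, -⟩ := h
  exact Group.fg_of_surjective hφ

lemma finiteIndex_range_piMap_subtype {I : Type*} [Finite I] {Γ : I → Type*} [∀ i, Group (Γ i)]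
    {E : ∀ i, Subgroup (Γ i)} (hE : ∀ i, (E i).FiniteIndex) :
    (MonoidHom.piMap fun i => (E i).subtype).range.FiniteIndex := by
  have : (MonoidHom.piMap fun i => (E i).subtype).range =
      ⨅ i, (E i).comap (Pi.evalMonoidHom Γ i) := by
    ext g
    simp only [MonoidHom.mem_range, Subgroup.mem_iInf, Subgroup.mem_comap]
    constructor
    · rintro ⟨d, rfl⟩ i
      exact (d i).2
    · exact fun h => ⟨fun i => ⟨g i, h i⟩, rfl⟩
  rw [this]
  exact Subgroup.finiteIndex_iInf fun i => finiteIndex_comap _ (hE i)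

lemma piMap_subtype_injective {I : Type*} {Γ : I → Type*} [∀ i, Group (Γ i)]
    (E : ∀ i, Subgroup (Γ i)) :
    Function.Injective (MonoidHom.piMap fun i => (E i).subtype) :=
  fun _ _ h => funext fun i => Subtype.ext (congrFun h i)

lemma preceq_of_le {δ f g : ℕ → ℕ} (hf : Monotone f) (hg : Monotone g) {K : ℕ}
    (hδ : ∀ l, δ l ≤ K * ((l + 1) * f (K * (l + 1) ^ 2) + g (K * (l + 1)) + (l + 1))) :
    Preceq δ fun l => l * f (l ^ 2) + g l := by
  refine ⟨K + 1, fun l => (hδ l).trans ?_⟩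
  have h₁ : f (K * (l + 1) ^ 2) ≤ f (((K + 1) * l + (K + 1)) ^ 2) := hf (by
    have : ((K + 1) * l + (K + 1)) ^ 2 = (K + 1) ^ 2 * (l + 1) ^ 2 := by ring
    rw [this]
    exact Nat.mul_le_mul_right _ (by nlinarith))
  have h₂ : g (K * (l + 1)) ≤ g ((K + 1) * l + (K + 1)) := hg (by nlinarith)
  have h₃ : (l + 1) * f (K * (l + 1) ^ 2) ≤
      ((K + 1) * l + (K + 1)) * f (((K + 1) * l + (K + 1)) ^ 2) :=
    Nat.mul_le_mul (by nlinarith [Nat.zero_le (K * l)]) h₁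
  calc _ ≤ (K + 1) * (((K + 1) * l + (K + 1)) * f (((K + 1) * l + (K + 1)) ^ 2) +
        g ((K + 1) * l + (K + 1)) + (l + 1)) :=
        Nat.mul_le_mul (Nat.le_succ K) (by omega)
    _ = _ := by ring

lemma exists_pow_five_le {f : ℕ → ℕ} (hf : Monotone f) {K : ℕ}
    (hsq : ∀ m, m ^ 2 ≤ K * (f (K * m) + m)) :
    ∃ C, ∀ s, s ^ 5 ≤ C * (s * f (C * s ^ 2) + s) := by
  refine ⟨K + K ^ 2 + K ^ 3, fun s => ?_⟩
  obtain rfl | hs := Nat.eq_zero_or_pos s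
  · simp
  obtain ⟨F, hF⟩ : ∃ F, F = f ((K + K ^ 2 + K ^ 3) * s ^ 2) := ⟨_, rfl⟩
  have hs2 : s ≤ s ^ 2 := Nat.le_self_pow two_ne_zero s
  have hK : K ≤ K + K ^ 2 + K ^ 3 := by omega
  have h₁ : s ^ 2 ≤ K * (F + s) := (hsq s).trans <| Nat.mul_le_mul_left K <|
    Nat.add_le_add_right (hF ▸ hf (Nat.mul_le_mul hK hs2)) s
  have h₂ : (s ^ 2) ^ 2 ≤ K * (F + s ^ 2) := (hsq (s ^ 2)).trans <| Nat.mul_le_mul_left K <|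
    Nat.add_le_add_right (hF ▸ hf (Nat.mul_le_mul_right _ hK)) _
  have h₃ : F ≤ s * F := Nat.le_mul_of_pos_left F hs
  rw [← hF]
  calc s ^ 5 = s * (s ^ 2) ^ 2 := by ring
    _ ≤ s * (K * (F + K * (F + s))) := by gcongr; exact h₂.trans (by gcongr)
    _ = (K + K ^ 2) * (s * F) + K ^ 2 * s ^ 2 := by ring
    _ ≤ (K + K ^ 2) * (s * F) + K ^ 2 * (K * (s * F + s)) := by
      gcongr
      exact h₁.trans (by gcongr)
    _ ≤ (K + K ^ 2 + K ^ 3) * (s * F + s) := by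
      nlinarith [Nat.zero_le (K * s), Nat.zero_le (K ^ 2 * s)]

/-- Restricting to finite-index subgroups of the factors preserves isoperimetric bounds. -/
lemma Presents.exists_fills_pi_subgroup {I : Type} [Finite I] {Γ : I → Type} [∀ i, Group (Γ i)]
    [∀ i, Group.FG (Γ i)] {E : ∀ i, Subgroup (Γ i)} (hE : ∀ i, (E i).FiniteIndex) {X : Type}
    [Finite X] {R : Set (FreeGroup X)} {φ : FreeGroup X →* ∀ i, Γ i} (hR : R.Finite)
    (h : Presents R φ) :
    ∃ (Y : Type) (_ : Finite Y) (ψ : FreeGroup Y →* ∀ i, E i) (S : Set (FreeGroup Y)) (C : ℕ),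
      Fills ψ S fun l => dehn R (C * l) + l := by
  obtain ⟨Y, _, ψ, hψ⟩ := Group.fg_iff_exists_freeGroup_hom_surjective_finite.1
    (inferInstance : Group.FG (∀ i, E i))
  obtain ⟨S, C, hS⟩ := (h.fills hR).of_finiteIndex (piMap_subtype_injective E)
    (finiteIndex_range_piMap_subtype hE) hψ
  exact ⟨Y, inferInstance, ψ, S, C, hS⟩

/-- The isoperimetric bound for the kernel of a product of epimorphisms onto `ℤ^κ`. -/
theorem preceq_dehn_of_finiteIndex {I κ : Type} [Fintype I] [Fintype κ] [DecidableEq I]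
    [DecidableEq κ] [Nontrivial I] {c : κ → I} (hc : Function.Injective c)
    {Γ : I → Type} {Δ : κ → Type} [∀ i, Group (Γ i)] [∀ k, Group (Δ k)] [∀ i, Group.FG (Γ i)]
    [∀ k, Group.FG (Δ k)] {E : ∀ i, Subgroup (Γ i)} {F : ∀ k, Subgroup (Δ k)}
    (hE : ∀ i, (E i).FiniteIndex) (hF : ∀ k, (F k).FiniteIndex)
    {θ : ∀ i, E i →* Multiplicative (κ → ℤ)}
    {η : ∀ k, F k →* Multiplicative (κ → ℤ)} (hθ : ∀ i, Function.Surjective (θ i))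
    (hη : ∀ k, Function.Surjective (η k)) {G H : Type} [Group G] [Group H] {pA : G →* ∀ i, E i}
    {pB : G →* ∀ k, F k} (hinj : ∀ g, pA g = 1 → pB g = 1 → g = 1)
    (hrange : ∀ g, (∏ i, θ i (pA g i)) * ∏ k, η k (pB g k) = 1)
    (hsurj : ∀ a b, (∏ i, θ i (a i)) * ∏ k, η k (b k) = 1 → ∃ g, pA g = a ∧ pB g = b)
    {ι : G →* H} (hι : Function.Injective ι) (hfin : ι.range.FiniteIndex)
    {X Y Z : Type} [Finite X] [Finite Y] [Finite Z] {φ : FreeGroup X →* ∀ i, Γ i}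
    {ψ : FreeGroup Y →* ∀ k, Δ k} {χ : FreeGroup Z →* H} {R : Set (FreeGroup X)}
    {S : Set (FreeGroup Y)} {U : Set (FreeGroup Z)} (hRfin : R.Finite) (hSfin : S.Finite)
    (hR : Presents R φ) (hS : Presents S ψ) (hU : Presents U χ) :
    Preceq (dehn U) fun l => l * dehn R (l ^ 2) + dehn S l := by
  obtain ⟨X', _, φ', R', C₁, hR'⟩ := hR.exists_fills_pi_subgroup hE hRfin
  obtain ⟨Y', _, ψ', S', C₂, hS'⟩ := hS.exists_fills_pi_subgroup hF hSfin
  have hmR : Monotone (dehn R) := dehn_mono R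
  have hmS : Monotone (dehn S) := dehn_mono S
  obtain hκ | hκ := isEmpty_or_nonempty κ
  · have hpA : Function.Bijective pA := by
      refine ⟨(injective_iff_map_eq_one _).2 fun g hg => hinj g hg (Subsingleton.elim _ _),
        fun a => ?_⟩
      obtain ⟨g, hg, -⟩ := hsurj a 1 (Subsingleton.elim _ _)
      exact ⟨g, hg⟩
    have hι' : (ι.comp (MulEquiv.ofBijective pA hpA).symm.toMonoidHom).range.FiniteIndex := by
      rwa [MonoidHom.range_comp, MonoidHom.range_eq_top.2 (MulEquiv.surjective _),
        ← MonoidHom.range_eq_map]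
    obtain ⟨U', C, hU'⟩ := Fills.of_finiteIndex_range
      (ι := ι.comp (MulEquiv.ofBijective pA hpA).symm.toMonoidHom)
      (hι.comp (MulEquiv.injective _)) hι' hR' hU.1
    obtain ⟨K, hK⟩ := hU'.dehn_le hU
    refine preceq_of_le (K := K * (C + 1) + C₁ * C) hmR hmS fun l => (hK l).trans ?_
    have h₁ : dehn R (C₁ * (C * l)) ≤ dehn R ((K * (C + 1) + C₁ * C) * (l + 1) ^ 2) := by
      refine hmR ?_
      rw [← mul_assoc]
      exact Nat.mul_le_mul (Nat.le_add_left _ _) (by nlinarith)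
    generalize dehn R ((K * (C + 1) + C₁ * C) * (l + 1) ^ 2) = F at h₁ ⊢
    calc _ ≤ K * (F + C * l + l) := by gcongr
      _ ≤ K * ((C + 1) * ((l + 1) * F + (l + 1))) := by
        gcongr
        nlinarith [Nat.zero_le (C * F), Nat.zero_le (C * l * F), Nat.zero_le (l * F)]
      _ = (K * (C + 1)) * ((l + 1) * F + 0 + (l + 1)) := by ring
      _ ≤ _ := by gcongr <;> omega
  · obtain ⟨V, _, π, W, C₃, hW⟩ := exists_fills_prod_mul_prod_eq_one hc hθ hη hinj hrange hsurj
      (fun _ _ h => add_le_add (hmR (Nat.mul_le_mul_left _ h)) h)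
      (fun _ _ h => add_le_add (hmS (Nat.mul_le_mul_left _ h)) h) hR' hS'
    obtain ⟨U', C, hU'⟩ := Fills.of_finiteIndex_range hι hfin hW hU.1
    obtain ⟨K, hK⟩ := hU'.dehn_le hU
    obtain ⟨K', C', hsq⟩ := hR'.sq_le_of_pi hθ
    obtain ⟨C₅, h₅⟩ := exists_pow_five_le (K := K' * (C' + 1) + C₁ * C') hmR fun m =>
      (hsq m).trans <| by
        have h₁ : dehn R (C₁ * (C' * m)) ≤ dehn R ((K' * (C' + 1) + C₁ * C') * m) := by
          refine hmR ?_
          rw [← mul_assoc]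
          exact Nat.mul_le_mul_right _ (Nat.le_add_left _ _)
        generalize dehn R ((K' * (C' + 1) + C₁ * C') * m) = F at h₁ ⊢
        calc _ ≤ K' * (F + C' * m) := by gcongr
          _ ≤ K' * ((C' + 1) * (F + m)) := by
            gcongr
            nlinarith [Nat.zero_le (C' * F)]
          _ = (K' * (C' + 1)) * (F + m) := by ring
          _ ≤ _ := by gcongr; omega
    obtain ⟨P, hP⟩ : ∃ P, P = 3 + 3 * C₃ * C + C₃ * (C + 1) ^ 5 * C₅ := ⟨_, rfl⟩
    refine preceq_of_le (K := K * P + C₁ * C₃ * C + C₂ * C₃ * C + C₅) hmR hmS fun l =>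
      (hK l).trans ?_
    generalize hM : K * P + C₁ * C₃ * C + C₂ * C₃ * C + C₅ = M
    have hl : l ≤ (l + 1) ^ 2 := by nlinarith
    have h₁ : dehn R (C₁ * (C₃ * (C * l))) ≤ dehn R (M * (l + 1) ^ 2) := by
      refine hmR ?_
      rw [← mul_assoc, ← mul_assoc]
      exact Nat.mul_le_mul (by omega) hl
    have h₂ : dehn S (C₂ * (C₃ * (C * l))) ≤ dehn S (M * (l + 1)) := by
      refine hmS ?_
      rw [← mul_assoc, ← mul_assoc]
      exact Nat.mul_le_mul (by omega) l.le_succ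
    have h₃ : dehn R (C₅ * (l + 1) ^ 2) ≤ dehn R (M * (l + 1) ^ 2) :=
      hmR (Nat.mul_le_mul_right _ (by omega))
    generalize dehn R (M * (l + 1) ^ 2) = F at h₁ h₃ ⊢
    generalize dehn S (M * (l + 1)) = T at h₂ ⊢
    have h₄ : (C * l + 1) ^ 5 ≤ (C + 1) ^ 5 * (C₅ * ((l + 1) * F + (l + 1))) :=
      calc (C * l + 1) ^ 5 ≤ ((C + 1) * (l + 1)) ^ 5 := by gcongr; nlinarith
        _ = (C + 1) ^ 5 * (l + 1) ^ 5 := mul_pow _ _ _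
        _ ≤ _ := by gcongr; exact (h₅ (l + 1)).trans (by gcongr)
    calc _ ≤ K * (2 * (F + C₃ * (C * l)) + (T + C₃ * (C * l)) +
          C₃ * ((C + 1) ^ 5 * (C₅ * ((l + 1) * F + (l + 1)))) + l) := by gcongr
      _ ≤ K * (P * ((l + 1) * F + T + (l + 1))) := by
        gcongr
        rw [hP]
        have h₅ : C₃ * C * l ≤ C₃ * C * ((l + 1) * F + T + (l + 1)) := by
          gcongr
          omega
        have h₆ : C₃ * (C + 1) ^ 5 * C₅ * ((l + 1) * F + (l + 1)) ≤
            C₃ * (C + 1) ^ 5 * C₅ * ((l + 1) * F + T + (l + 1)) := by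
          gcongr
          omega
        have h₇ : F ≤ (l + 1) * F := Nat.le_mul_of_pos_left F l.succ_pos
        linarith
      _ = (K * P) * ((l + 1) * F + T + (l + 1)) := by ring
      _ ≤ _ := by gcongr; omega

/-- If `H` is a virtually-full, virtually-coabelian subgroup of corank `r` of a direct product
of `n ≥ max{3, 2r}` finitely presented groups, and `β₁, β₂` are Dehn functions of finite
presentations of `Γ₁ × … × Γ_{n-r}` and `Γ_{n-r+1} × … × Γ_n`, then
`β(l) = l·β₁(l²) + β₂(l)` is an isoperimetric function for `H`. -/
theorem virtuallyFull_virtuallyCoabelian_isoperimetric_two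
    (n : ℕ) (hn : 3 ≤ n) (Γ : Fin n → Type) [∀ i, Group (Γ i)]
    (hfp : ∀ i, FinitelyPresentedGroup (Γ i))
    (H : Subgroup (∀ i, Γ i))
    (hfull : ∀ i, ((MonoidHom.mulSingle Γ i).range ⊔ H).FiniteIndex)
    (D' : Subgroup (∀ i, Γ i)) (hD'fi : D'.FiniteIndex) (hco : ⁅D', D'⁆ ≤ H)
    -- the corank of `H` is `r`: the quotient `D'/(H ∩ D')` has `ℚ`-corank `r`
    (r : ℕ) (Q : Type) [CommGroup Q] (q : ↥D' →* Q)
    (hqsurj : Function.Surjective q) (hqker : q.ker = H.subgroupOf D')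
    (hrank : Module.rank ℚ (ℚ ⊗[ℤ] Additive Q) = r)
    (h2r : 2 * r ≤ n)
    -- `β₁` is the Dehn function of a finite presentation of `Γ₁ × … × Γ_{n-r}`
    (β₁ : ℕ → ℕ)
    (hβ₁ : ∃ (X : Type) (_ : Finite X) (R : Set (FreeGroup X))
        (φ : FreeGroup X →* (∀ i : Fin (n - r), Γ (Fin.castLE (by omega) i))),
      R.Finite ∧ Presents R φ ∧ β₁ = dehn R)
    -- `β₂` is the Dehn function of a finite presentation of `Γ_{n-r+1} × … × Γ_n`
    (β₂ : ℕ → ℕ)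
    (hβ₂ : ∃ (X : Type) (_ : Finite X) (R : Set (FreeGroup X))
        (φ : FreeGroup X →* (∀ i : Fin r, Γ ⟨n - r + i.val, by have := i.isLt; omega⟩)),
      R.Finite ∧ Presents R φ ∧ β₂ = dehn R) :
    IsIsopFunction H (fun l => l * β₁ (l ^ 2) + β₂ l) := by
  obtain ⟨X, _, R, φ, hRfin, hR, rfl⟩ := hβ₁
  obtain ⟨Y, _, S, ψ, hSfin, hS, rfl⟩ := hβ₂
  intro Z U χ _ _ hU
  have : ∀ i, Group.FG (Γ i) := fun i => (hfp i).fg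
  obtain ⟨E, θ, hE, hθ, hEH⟩ := exists_finiteIndex_factors hfull hD'fi hqsurj hqker hrank
  have hr : r ≤ n := by omega
  have : Nontrivial (Fin (n - r)) := Fin.nontrivial_iff_two_le.2 (by omega)
  let A : Fin (n - r) → Fin n := Fin.castLE (Nat.sub_le n r)
  let B : Fin r → Fin n := fun i => ⟨n - r + i.val, by have := i.isLt; omega⟩
  let e : Fin (n - r) ⊕ Fin r ≃ Fin n := finSumFinEquiv.trans (finCongr (Nat.sub_add_cancel hr))
  have heA : ∀ i, e (.inl i) = A i := fun _ => rfl
  have heB : ∀ k, e (.inr k) = B k := fun _ => rfl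
  have hprod : ∀ d : ∀ i, E i, (∏ i, θ (A i) (d (A i))) * ∏ k, θ (B k) (d (B k)) =
      ∏ i, θ i (d i) := fun d => by
    rw [← e.prod_comp, Fintype.prod_sum_type]
    rfl
  let G : Subgroup H := (Subgroup.pi Set.univ E).subgroupOf H
  let d : G →* ∀ i, E i := MonoidHom.pi fun i =>
    ((Pi.evalMonoidHom Γ i).comp (H.subtype.comp G.subtype)).codRestrict (E i)
      fun g => g.2 i (Set.mem_univ i)
  have hd : ∀ g i, (d g i : Γ i) = (g : H).1 i := fun _ _ => rfl
  have hdH : ∀ g, ∏ i, θ i (d g i) = 1 := fun g => (hEH (d g)).2 (g : H).2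
  have hG : G.FiniteIndex := by
    have := finiteIndex_range_piMap_subtype hE
    have : (Subgroup.pi Set.univ E).FiniteIndex := Subgroup.finiteIndex_of_le
      (H := (MonoidHom.piMap fun i => (E i).subtype).range) <| by
        rintro _ ⟨d, rfl⟩ i -
        exact (d i).2
    infer_instance
  refine preceq_dehn_of_finiteIndex (c := Fin.castLE (by omega)) (Fin.castLE_injective _)
    (E := fun i => E (A i)) (F := fun k => E (B k)) (θ := fun i => θ (A i))
    (η := fun k => θ (B k)) (fun i => hE _) (fun k => hE _) (fun i => hθ _) (fun k => hθ _)
    (pA := MonoidHom.pi fun i => (Pi.evalMonoidHom _ (A i)).comp d)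
    (pB := MonoidHom.pi fun k => (Pi.evalMonoidHom _ (B k)).comp d) ?_ ?_ ?_
    (ι := G.subtype) G.subtype_injective (by rwa [Subgroup.range_subtype])
    hRfin hSfin hR hS hU
  · intro g hA hB
    have hg : ∀ i, d g i = 1 := e.surjective.forall.2 <|
      Sum.forall.2 ⟨fun i => congrFun hA i, fun k => congrFun hB k⟩
    exact Subtype.ext <| Subtype.ext <| funext fun i => congrArg Subtype.val (hg i)
  · exact fun g => (hprod (d g)).trans (hdH g)
  · intro a b hab
    let t : ∀ s, E (e s) := Sum.rec a b
    obtain ⟨x, hx⟩ : ∃ x : ∀ i, E i, ∀ s, x (e s) = t s :=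
      ⟨e.piCongrLeft (fun i => E i) t, fun s => e.piCongrLeft_apply_apply (fun i => E i) t s⟩
    have hxA : ∀ i, x (A i) = a i := fun i => hx (.inl i)
    have hxB : ∀ k, x (B k) = b k := fun k => hx (.inr k)
    have hxH : (fun i => (x i : Γ i)) ∈ H := by
      rw [← hEH, ← hprod]
      simpa only [hxA, hxB] using hab
    exact ⟨⟨⟨_, hxH⟩, fun i _ => (x i).2⟩, funext hxA, funext hxB⟩
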